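/- (Scaled interior pointwise estimate.) There exist constants ᾱ ∈ (0,1) and C > 0 depending only on λ and Λ such that the following holds. Let 0 < r ≤ 1, x₀ ∈ ℝ², and let v ∈ C²(B̄_r(x₀)) be a classical solution of F(D²v) = 0 in B_r(x₀) ⊂ ℝ², where F is of class C¹, uniformly elliptic with constants λ, Λ, and F(0) = 0. Then there exists a quadratic polynomial P such that |v(x) − P(x)| ≤ C‖v‖_{L^∞(B_r(x₀))} r^{−(2+ᾱ)} |x − x₀|^{2+ᾱ} for all x ∈ B_{r/2}(x₀), |P(x₀)| ≤ C‖v‖_{L^∞(B_r(x₀))}, |DP(x₀)| ≤ C r^{−1}‖v‖_{L^∞(B_r(x₀))}, and |D²P| ≤ C r^{−2}‖v‖_{L^∞(B_r(x₀))}. -/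

import Mathlib

open Metric Set Real
open scoped Classical

noncomputable section

abbrev E2 : Type := EuclideanSpace ℝ (Fin 2)
abbrev Mat2 : Type := Matrix (Fin 2) (Fin 2) ℝ

/-- `‖A⁺‖`: the sum of the positive parts of the eigenvalues of a symmetric matrix `A`. -/
noncomputable def posNorm (A : Mat2) : ℝ :=
  if h : A.IsHermitian then ∑ i, max (h.eigenvalues i) 0 else 0

/-- `‖A⁻‖`: the sum of the negative parts of the eigenvalues of a symmetric matrix `A`. -/
noncomputable def negNorm (A : Mat2) : ℝ :=
  if h : A.IsHermitian then ∑ i, max (-(h.eigenvalues i)) 0 else 0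

/-- A norm on 2×2 matrices: sum of absolute values of entries. -/
noncomputable def matNorm (A : Mat2) : ℝ := ∑ i, ∑ j, |A i j|

/-- `F` is uniformly elliptic with constants `0 < lam ≤ Lam`:
`F M - F N ≤ Lam ‖(M-N)⁺‖ - lam ‖(M-N)⁻‖` for all symmetric `M, N`. -/
def UniformlyElliptic (lam Lam : ℝ) (F : Mat2 → ℝ) : Prop :=
  ∀ M N : Mat2, M.IsHermitian → N.IsHermitian →
    F M - F N ≤ Lam * posNorm (M - N) - lam * negNorm (M - N)

/-- The Hessian matrix `D²u(x)` of `u : ℝ² → ℝ` at `x`. -/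
noncomputable def hess (u : E2 → ℝ) (x : E2) : Mat2 :=
  Matrix.of fun i j =>
    fderiv ℝ (fun y => fderiv ℝ u y (EuclideanSpace.single j 1)) x (EuclideanSpace.single i 1)

/-- `sup_s |u|`, the `L^∞` norm of `u` on `s`. -/
noncomputable def supAbs (u : E2 → ℝ) (s : Set E2) : ℝ := ⨆ x ∈ s, |u x|

noncomputable def vecNorm (v : Fin 2 → ℝ) : ℝ := Real.sqrt (∑ i, (v i) ^ 2)

/-- A quadratic polynomial on ℝ², `P(x) = a + b·x + ½ xᵀQx` with `Q = D²P` symmetric. -/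
structure QuadPoly where
  a : ℝ
  b : Fin 2 → ℝ
  Q : Mat2
  symm : Q.IsHermitian

noncomputable def QuadPoly.eval (P : QuadPoly) (x : E2) : ℝ :=
  P.a + (∑ i, P.b i * x i) + (1 / 2) * ∑ i, ∑ j, P.Q i j * x i * x j

/-- The gradient `DP(x) = b + Qx` of a quadratic polynomial. -/
noncomputable def QuadPoly.grad (P : QuadPoly) (x : E2) : Fin 2 → ℝ :=
  fun i => P.b i + ∑ j, P.Q i j * x j


lemma stokes_abs (P Q Pr Pt Qr Qt : ℝ → ℝ → ℝ)
    (cP : Continuous (Function.uncurry P)) (cQ : Continuous (Function.uncurry Q))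
    (cPr : Continuous (Function.uncurry Pr)) (cPt : Continuous (Function.uncurry Pt))
    (cQr : Continuous (Function.uncurry Qr)) (cQt : Continuous (Function.uncurry Qt))
    (hPr : ∀ r t, HasDerivAt (fun r => P r t) (Pr r t) r)
    (hPt : ∀ r t, HasDerivAt (fun t => P r t) (Pt r t) t)
    (hQr : ∀ r t, HasDerivAt (fun r => Q r t) (Qr r t) r)
    (hQt : ∀ r t, HasDerivAt (fun t => Q r t) (Qt r t) t)
    (pP : ∀ r, Function.Periodic (P r) (2 * π))
    (pQr : ∀ r, Function.Periodic (Qr r) (2 * π)) (R : ℝ) :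
    (∫ t in (0:ℝ)..(2 * π), P R t * Qt R t) - (∫ t in (0:ℝ)..(2 * π), P 0 t * Qt 0 t)
      = ∫ r in (0:ℝ)..R, ∫ t in (0:ℝ)..(2 * π), (Pr r t * Qt r t - Pt r t * Qr r t) := by
  have cP' : Continuous fun z : ℝ × ℝ => P z.1 z.2 := cP
  have cQ' : Continuous fun z : ℝ × ℝ => Q z.1 z.2 := cQ
  have cPr' : Continuous fun z : ℝ × ℝ => Pr z.1 z.2 := cPr
  have cPt' : Continuous fun z : ℝ × ℝ => Pt z.1 z.2 := cPt
  have cQr' : Continuous fun z : ℝ × ℝ => Qr z.1 z.2 := cQr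
  have cQt' : Continuous fun z : ℝ × ℝ => Qt z.1 z.2 := cQt
  have key : ∀ (A At : ℝ → ℝ → ℝ), Continuous (Function.uncurry At) →
      (∀ r t, HasDerivAt (fun t => A r t) (At r t) t) → ∀ h r t,
      h * (∫ u in (0:ℝ)..1, At r (t + u * h)) = A r (t + h) - A r t := by
    intro A At cAt hA h r t
    have cAt' : Continuous fun z : ℝ × ℝ => At z.1 z.2 := cAt
    have : ∫ u in (0:ℝ)..1, (At r (t + u * h)) * h = A r (t + 1 * h) - A r (t + 0 * h) := by
      apply intervalIntegral.integral_eq_sub_of_hasDerivAt (f := fun u : ℝ => A r (t + u * h))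
      · intro u _
        have h1 : HasDerivAt (fun u : ℝ => t + u * h) h u := by
          simpa using ((hasDerivAt_id u).mul_const h).const_add t
        exact (hA r (t + u * h)).comp u h1
      · exact (Continuous.intervalIntegrable (by fun_prop) _ _)
    rw [intervalIntegral.integral_mul_const] at this
    simp only [one_mul, zero_mul, add_zero] at this
    rw [← this, mul_comm]
  set DQ : ℝ → ℝ → ℝ → ℝ := fun h r t => ∫ u in (0:ℝ)..1, Qt r (t + u * h) with hDQ
  set DP : ℝ → ℝ → ℝ → ℝ := fun h r t => ∫ u in (0:ℝ)..1, Pt r (t + u * h) with hDP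
  have cDQ : Continuous fun z : ℝ × ℝ × ℝ => DQ z.1 z.2.1 z.2.2 := by
    simp only [hDQ]; fun_prop
  have cDP : Continuous fun z : ℝ × ℝ × ℝ => DP z.1 z.2.1 z.2.2 := by
    simp only [hDP]; fun_prop
  have kQ := key Q Qt cQt hQt
  have kP := key P Pt cPt hPt
  set L : ℝ → ℝ := fun h => (∫ t in (0:ℝ)..(2 * π), P R t * DQ h R t)
      - (∫ t in (0:ℝ)..(2 * π), P 0 t * DQ h 0 t) with hL
  set M : ℝ → ℝ := fun h => ∫ r in (0:ℝ)..R, ∫ t in (0:ℝ)..(2 * π),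
      (Pr r t * DQ h r t - DP (-h) r t * Qr r t) with hM
  have cL : Continuous L := by simp only [hL]; fun_prop
  have cM : Continuous M := by simp only [hM]; fun_prop
  have hLM : ∀ h, h ≠ 0 → L h = M h := by
    intro h hh
    apply mul_left_cancel₀ hh
    have s1 : h * L h = ∫ t in (0:ℝ)..(2 * π), ∫ r in (0:ℝ)..R,
        (Pr r t * (Q r (t + h) - Q r t) + P r t * (Qr r (t + h) - Qr r t)) := by
      simp only [hL]
      rw [← intervalIntegral.integral_sub, ← intervalIntegral.integral_const_mul]
      · apply intervalIntegral.integral_congr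
        intro t _
        simp only
        rw [intervalIntegral.integral_eq_sub_of_hasDerivAt
          (f := fun r => P r t * (Q r (t + h) - Q r t))]
        · rw [← kQ h R t, ← kQ h 0 t]; ring
        · intro r _
          exact (hPr r t).mul ((hQr r (t + h)).sub (hQr r t))
        · exact (Continuous.intervalIntegrable (by fun_prop) _ _)
      · exact (Continuous.intervalIntegrable (by fun_prop) _ _)
      · exact (Continuous.intervalIntegrable (by fun_prop) _ _)
    have s2 : (∫ t in (0:ℝ)..(2 * π), ∫ r in (0:ℝ)..R,
        (Pr r t * (Q r (t + h) - Q r t) + P r t * (Qr r (t + h) - Qr r t)))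
        = ∫ r in (0:ℝ)..R, ∫ t in (0:ℝ)..(2 * π),
        (Pr r t * (Q r (t + h) - Q r t) + P r t * (Qr r (t + h) - Qr r t)) := by
      apply MeasureTheory.intervalIntegral_intervalIntegral_swap
      have cc : Continuous (Function.uncurry fun t r =>
          (Pr r t * (Q r (t + h) - Q r t) + P r t * (Qr r (t + h) - Qr r t))) := by
        simp only [Function.uncurry_def]; fun_prop
      exact (cc.continuousOn.integrableOn_compact
        (isCompact_uIcc.prod isCompact_uIcc)).mono_set
        (Set.prod_mono Set.uIoc_subset_uIcc Set.uIoc_subset_uIcc)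
    rw [s1, s2]
    simp only [hM]
    rw [← intervalIntegral.integral_const_mul]
    apply intervalIntegral.integral_congr
    intro r _
    simp only
    have s3 : ∫ t in (0:ℝ)..(2 * π), P r t * Qr r (t + h)
        = ∫ t in (0:ℝ)..(2 * π), P r (t - h) * Qr r t := by
      have e1 : ∫ t in (0:ℝ)..(2 * π), P r t * Qr r (t + h)
        = ∫ t in (0:ℝ)..(2 * π), (fun t => P r (t - h) * Qr r t) (t + h) := by simp
      rw [e1, intervalIntegral.integral_comp_add_right (fun t => P r (t - h) * Qr r t)]
      have per : Function.Periodic (fun t => P r (t - h) * Qr r t) (2 * π) := by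
        intro t
        simp only
        rw [show t + 2 * π - h = t - h + 2 * π by ring, pP r, pQr r]
      have := per.intervalIntegral_add_eq h 0
      rw [show h + 2 * π = 2 * π + h by ring] at this
      simpa using this
    rw [← intervalIntegral.integral_const_mul]
    have e2 : ∀ t, h * (Pr r t * DQ h r t - DP (-h) r t * Qr r t)
        = Pr r t * (Q r (t + h) - Q r t) + (P r (t - h) * Qr r t - P r t * Qr r t) := by
      intro t
      rw [← kQ h r t]
      have := kP (-h) r t
      rw [← sub_eq_add_neg] at this
      linear_combination (Qr r t) * this
    simp only [e2]
    simp only [mul_sub (P _ _)]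
    rw [intervalIntegral.integral_add, intervalIntegral.integral_add,
      intervalIntegral.integral_sub, intervalIntegral.integral_sub, s3]
    all_goals exact (Continuous.intervalIntegrable (by fun_prop) _ _)
  have hEq : L 0 = M 0 := by
    have t1 : Filter.Tendsto L (nhdsWithin 0 {0}ᶜ) (nhds (L 0)) := cL.continuousAt.mono_left nhdsWithin_le_nhds
    have t2 : Filter.Tendsto M (nhdsWithin 0 {0}ᶜ) (nhds (M 0)) := cM.continuousAt.mono_left nhdsWithin_le_nhds
    refine tendsto_nhds_unique t1 (t2.congr' ?_)
    filter_upwards [self_mem_nhdsWithin] with h hh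
    exact (hLM h hh).symm
  simpa [hL, hM, hDQ, hDP] using hEq

/-- partial derivative -/
def pd (i : Fin 2) (f : E2 → ℝ) (x : E2) : ℝ := fderiv ℝ f x (EuclideanSpace.single i 1)

def cp (r t : ℝ) : E2 := !₂[r * cos t, r * sin t]

lemma cp_eq (r t : ℝ) : cp r t = (r * cos t) • (EuclideanSpace.single 0 1 : E2)
    + (r * sin t) • (EuclideanSpace.single 1 1 : E2) := by
  ext i; fin_cases i <;> simp [cp]

lemma cp_cont : Continuous fun z : ℝ × ℝ => cp z.1 z.2 := by
  simp only [cp_eq]; fun_prop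

@[fun_prop]
lemma cp_cont' {X : Type*} [TopologicalSpace X] {f g : X → ℝ} (hf : Continuous f)
    (hg : Continuous g) : Continuous fun x => cp (f x) (g x) := by
  simp only [cp_eq]; fun_prop

lemma cp_norm (r t : ℝ) : ‖cp r t‖ = |r| := by
  rw [EuclideanSpace.norm_eq, ← Real.sqrt_sq_eq_abs]
  congr 1
  simp [cp, Fin.sum_univ_two]
  nlinarith [sin_sq_add_cos_sq t]

lemma cp_per (r : ℝ) : Function.Periodic (cp r) (2 * π) := by
  intro t; simp [cp]

lemma cp_surj (x : E2) : ∃ t, cp ‖x‖ t = x := by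
  have h : (‖x‖)^2 = x 0 ^ 2 + x 1 ^ 2 := by
    rw [EuclideanSpace.norm_sq_eq]; simp [Fin.sum_univ_two]
  have hz : ‖(⟨x 0, x 1⟩ : ℂ)‖ = ‖x‖ := by
    rw [← sq_eq_sq₀ (norm_nonneg _) (norm_nonneg _), h, Complex.sq_norm, Complex.normSq_mk]; ring
  refine ⟨Complex.arg ⟨x 0, x 1⟩, ?_⟩
  rw [← hz]
  ext i
  fin_cases i
  · simp [cp, Complex.norm_mul_cos_arg]
  · simp [cp, Complex.norm_mul_sin_arg]

lemma pd_comb (f : E2 → ℝ) (x : E2) (a b : ℝ) :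
    fderiv ℝ f x (a • (EuclideanSpace.single 0 1 : E2) + b • (EuclideanSpace.single 1 1 : E2))
      = a * pd 0 f x + b * pd 1 f x := by
  simp [pd]

lemma pd_cont {f : E2 → ℝ} (hf : ContDiff ℝ 1 f) (i : Fin 2) : Continuous (pd i f) := by
  have := hf.continuous_fderiv (by norm_num)
  unfold pd; fun_prop

lemma cp_deriv_r {f : E2 → ℝ} (hf : Differentiable ℝ f) (r t : ℝ) :
    HasDerivAt (fun r => f (cp r t)) (cos t * pd 0 f (cp r t) + sin t * pd 1 f (cp r t)) r := by
  have h1 : HasDerivAt (fun r => cp r t) (cos t • (EuclideanSpace.single 0 1 : E2)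
    + sin t • (EuclideanSpace.single 1 1 : E2)) r := by
    simp only [cp_eq]
    have a := ((hasDerivAt_id r).mul_const (cos t)).smul_const (EuclideanSpace.single 0 1 : E2)
    have b := ((hasDerivAt_id r).mul_const (sin t)).smul_const (EuclideanSpace.single 1 1 : E2)
    have c := a.add b
    simp only [one_mul] at c
    exact c
  have := (hf (cp r t)).hasFDerivAt.comp_hasDerivAt r h1
  rw [pd_comb] at this
  exact this

lemma cp_deriv_t {f : E2 → ℝ} (hf : Differentiable ℝ f) (r t : ℝ) :
    HasDerivAt (fun t => f (cp r t))
      (r * (-sin t * pd 0 f (cp r t) + cos t * pd 1 f (cp r t))) t := by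
  have h1 : HasDerivAt (fun t => cp r t) ((r * -sin t) • (EuclideanSpace.single 0 1 : E2)
    + (r * cos t) • (EuclideanSpace.single 1 1 : E2)) t := by
    simp only [cp_eq]
    have a := ((hasDerivAt_cos t).const_mul r).smul_const (EuclideanSpace.single 0 1 : E2)
    have b := ((hasDerivAt_sin t).const_mul r).smul_const (EuclideanSpace.single 1 1 : E2)
    exact a.add b
  have := (hf (cp r t)).hasFDerivAt.comp_hasDerivAt t h1
  rw [pd_comb] at this
  rw [show r * (-sin t * pd 0 f (cp r t) + cos t * pd 1 f (cp r t))
    = r * -sin t * pd 0 f (cp r t) + r * cos t * pd 1 f (cp r t) by ring]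
  exact this

/-- disk integral in polar coordinates -/
def J (R : ℝ) (g : E2 → ℝ) : ℝ := ∫ s in (0:ℝ)..R, ∫ t in (0:ℝ)..(2 * π), s * g (cp s t)

lemma stokes {G q : E2 → ℝ} (hG : ContDiff ℝ 1 G) (hq : ContDiff ℝ 1 q) (R : ℝ) :
    J R (fun x => pd 0 G x * pd 1 q x - pd 1 G x * pd 0 q x)
      = ∫ t in (0:ℝ)..(2 * π), G (cp R t) *
        (R * (-sin t * pd 0 q (cp R t) + cos t * pd 1 q (cp R t))) := by
  have dG := hG.differentiable (by norm_num)
  have dq := hq.differentiable (by norm_num)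
  have cG := hG.continuous
  have cq := hq.continuous
  have cG0 := pd_cont hG 0
  have cG1 := pd_cont hG 1
  have cq0 := pd_cont hq 0
  have cq1 := pd_cont hq 1
  have := stokes_abs (fun r t => G (cp r t)) (fun r t => q (cp r t))
    (fun r t => cos t * pd 0 G (cp r t) + sin t * pd 1 G (cp r t))
    (fun r t => r * (-sin t * pd 0 G (cp r t) + cos t * pd 1 G (cp r t)))
    (fun r t => cos t * pd 0 q (cp r t) + sin t * pd 1 q (cp r t))
    (fun r t => r * (-sin t * pd 0 q (cp r t) + cos t * pd 1 q (cp r t)))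
    (by simp only [Function.uncurry_def]; fun_prop) (by simp only [Function.uncurry_def]; fun_prop)
    (by simp only [Function.uncurry_def]; fun_prop) (by simp only [Function.uncurry_def]; fun_prop)
    (by simp only [Function.uncurry_def]; fun_prop) (by simp only [Function.uncurry_def]; fun_prop)
    (cp_deriv_r dG) (cp_deriv_t dG) (cp_deriv_r dq) (cp_deriv_t dq)
    (fun r t => by simp only [cp_per r t]) (fun r t => by simp only [cp_per r t, cos_add_two_pi, sin_add_two_pi]) R
  simp only [zero_mul, mul_zero, intervalIntegral.integral_zero, sub_zero] at this
  rw [this]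
  unfold J
  apply intervalIntegral.integral_congr
  intro r _
  apply intervalIntegral.integral_congr
  intro t _
  simp only
  have h := sin_sq_add_cos_sq t
  linear_combination (-r * (pd 0 G (cp r t) * pd 1 q (cp r t) - pd 1 G (cp r t) * pd 0 q (cp r t))) * h

lemma J_add {g h : E2 → ℝ} (hg : Continuous g) (hh : Continuous h) (R : ℝ) :
    J R (fun x => g x + h x) = J R g + J R h := by
  unfold J
  rw [← intervalIntegral.integral_add (Continuous.intervalIntegrable (by fun_prop) _ _)
    (Continuous.intervalIntegrable (by fun_prop) _ _)]
  apply intervalIntegral.integral_congr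
  intro r _
  simp only
  rw [← intervalIntegral.integral_add (Continuous.intervalIntegrable (by fun_prop) _ _)
    (Continuous.intervalIntegrable (by fun_prop) _ _)]
  simp only [mul_add]

lemma J_smul (c : ℝ) (g : E2 → ℝ) (R : ℝ) : J R (fun x => c * g x) = c * J R g := by
  unfold J
  rw [← intervalIntegral.integral_const_mul]
  apply intervalIntegral.integral_congr
  intro r _
  simp only
  rw [← intervalIntegral.integral_const_mul]
  apply intervalIntegral.integral_congr
  intro t _
  simp only; ring

lemma J_mono {g h : E2 → ℝ} (hg : Continuous g) (hh : Continuous h) {R : ℝ} (hR : 0 ≤ R)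
    (H : ∀ x, ‖x‖ ≤ R → g x ≤ h x) : J R g ≤ J R h := by
  unfold J
  apply intervalIntegral.integral_mono_on hR (Continuous.intervalIntegrable (by fun_prop) _ _)
    (Continuous.intervalIntegrable (by fun_prop) _ _)
  intro s hs
  apply intervalIntegral.integral_mono_on two_pi_pos.le
    (Continuous.intervalIntegrable (by fun_prop) _ _)
    (Continuous.intervalIntegrable (by fun_prop) _ _)
  intro t _
  apply mul_le_mul_of_nonneg_left _ hs.1
  apply H
  rw [cp_norm, abs_of_nonneg hs.1]; exact hs.2

lemma J_const (c R : ℝ) : J R (fun _ => c) = π * R ^ 2 * c := by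
  unfold J
  simp only [intervalIntegral.integral_const, smul_eq_mul, sub_zero]
  rw [intervalIntegral.integral_const_mul, intervalIntegral.integral_mul_const, integral_id]
  ring

lemma cs_circle {g : ℝ → ℝ} (hg : Continuous g) :
    (∫ t in (0:ℝ)..(2 * π), |g t|) ^ 2 ≤ 2 * π * ∫ t in (0:ℝ)..(2 * π), g t ^ 2 := by
  set A := ∫ t in (0:ℝ)..(2 * π), |g t| with hA
  have h0 : 0 ≤ ∫ t in (0:ℝ)..(2 * π), (|g t| - A / (2 * π)) ^ 2 :=
    intervalIntegral.integral_nonneg two_pi_pos.le (fun t _ => sq_nonneg _)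
  have h1 : ∫ t in (0:ℝ)..(2 * π), (|g t| - A / (2 * π)) ^ 2
      = (∫ t in (0:ℝ)..(2 * π), g t ^ 2) - 2 * (A / (2 * π)) * A + (2 * π) * (A / (2 * π)) ^ 2 := by
    have : ∀ t, (|g t| - A / (2 * π)) ^ 2
      = g t ^ 2 - 2 * (A / (2 * π)) * |g t| + (A / (2 * π)) ^ 2 := by
      intro t; rw [← sq_abs (g t)]; ring
    simp only [this]
    rw [intervalIntegral.integral_add, intervalIntegral.integral_sub,
      intervalIntegral.integral_const_mul, intervalIntegral.integral_const, ← hA]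
    · simp
    all_goals exact (Continuous.intervalIntegrable (by fun_prop) _ _)
  rw [h1] at h0
  have hpi : (0:ℝ) < 2 * π := two_pi_pos
  have h2 : 2 * (A / (2 * π)) * A = 2 * (A ^ 2 / (2 * π)) := by ring
  have h3 : (2 * π) * (A / (2 * π)) ^ 2 = A ^ 2 / (2 * π) := by field_simp
  rw [h2, h3] at h0
  have h4 : A ^ 2 / (2 * π) ≤ ∫ t in (0:ℝ)..(2 * π), g t ^ 2 := by linarith
  rw [div_le_iff₀ hpi] at h4
  linarith

lemma cp_surj' (x : E2) : ∃ t ∈ Icc (0:ℝ) (2 * π), cp ‖x‖ t = x := by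
  obtain ⟨t, ht⟩ := cp_surj x
  obtain ⟨s, hs, hs'⟩ := (cp_per ‖x‖).exists_mem_Ico₀ two_pi_pos t
  exact ⟨s, ⟨hs.1, hs.2.le⟩, by rw [← hs', ht]⟩

def D2 (p q : E2 → ℝ) (x : E2) : ℝ :=
  pd 0 p x ^ 2 + pd 1 p x ^ 2 + pd 0 q x ^ 2 + pd 1 q x ^ 2

def QR (K : ℝ) (p q : E2 → ℝ) (R : ℝ) : Prop :=
  ∀ x, ‖x‖ ≤ R → D2 p q x ≤ K * (pd 1 p x * pd 0 q x - pd 0 p x * pd 1 q x)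

lemma D2_nonneg (p q : E2 → ℝ) (x : E2) : 0 ≤ D2 p q x := by unfold D2; positivity

lemma D2_cont {p q : E2 → ℝ} (hp : ContDiff ℝ 1 p) (hq : ContDiff ℝ 1 q) :
    Continuous (D2 p q) := by
  have h0 := pd_cont hp 0
  have h1 := pd_cont hp 1
  have h2 := pd_cont hq 0
  have h3 := pd_cont hq 1
  unfold D2; fun_prop

def en (p q : E2 → ℝ) (s : ℝ) : ℝ := ∫ t in (0:ℝ)..(2 * π), D2 p q (cp s t)

lemma J_hasDeriv {p q : E2 → ℝ} (hp : ContDiff ℝ 1 p) (hq : ContDiff ℝ 1 q) (R : ℝ) :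
    HasDerivAt (fun R => J R (D2 p q)) (R * en p q R) R := by
  have hc := D2_cont hp hq
  have : (fun R => J R (D2 p q)) = fun R => ∫ s in (0:ℝ)..R, s * en p q s := by
    funext R; unfold J en
    simp only [intervalIntegral.integral_const_mul]
  rw [this]
  have c : Continuous fun s => s * en p q s := by unfold en; fun_prop
  exact intervalIntegral.integral_hasDerivAt_right (c.intervalIntegrable _ _)
    (c.stronglyMeasurableAtFilter _ _) c.continuousAt

def ang (p : E2 → ℝ) (r : ℝ) : ℝ :=
  ∫ t in (0:ℝ)..(2 * π), |(-sin t * pd 0 p (cp r t) + cos t * pd 1 p (cp r t))|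

lemma ang_nonneg (p : E2 → ℝ) (r : ℝ) : 0 ≤ ang p r :=
  intervalIntegral.integral_nonneg two_pi_pos.le (fun _ _ => abs_nonneg _)

lemma ang_sq {p : E2 → ℝ} (hp : ContDiff ℝ 1 p) (r : ℝ) :
    ang p r ^ 2 ≤ 2 * π * ∫ t in (0:ℝ)..(2 * π), (pd 0 p (cp r t) ^ 2 + pd 1 p (cp r t) ^ 2) := by
  have h0 := pd_cont hp 0
  have h1 := pd_cont hp 1
  refine (cs_circle (g := fun t => -sin t * pd 0 p (cp r t) + cos t * pd 1 p (cp r t))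
    (by fun_prop)).trans ?_
  apply mul_le_mul_of_nonneg_left _ two_pi_pos.le
  apply intervalIntegral.integral_mono_on two_pi_pos.le
    (Continuous.intervalIntegrable (by fun_prop) _ _)
    (Continuous.intervalIntegrable (by fun_prop) _ _)
  intro t _
  nlinarith [sq_nonneg (cos t * pd 0 p (cp r t) + sin t * pd 1 p (cp r t)), sin_sq_add_cos_sq t]

lemma osc_circle {p : E2 → ℝ} (hp : ContDiff ℝ 1 p) {r : ℝ} (hr : 0 ≤ r) {t : ℝ}
    (ht : t ∈ Icc (0:ℝ) (2 * π)) : |p (cp r t) - p (cp r 0)| ≤ r * ang p r := by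
  have h0 := pd_cont hp 0
  have h1 := pd_cont hp 1
  have := intervalIntegral.integral_eq_sub_of_hasDerivAt (a := 0) (b := t)
    (fun s _ => cp_deriv_t (hp.differentiable (by norm_num)) r s)
    (Continuous.intervalIntegrable (by fun_prop) _ _)
  rw [← this, intervalIntegral.integral_const_mul, abs_mul, abs_of_nonneg hr]
  apply mul_le_mul_of_nonneg_left _ hr
  refine (intervalIntegral.abs_integral_le_integral_abs ht.1).trans ?_
  unfold ang
  apply intervalIntegral.integral_mono_interval le_rfl ht.1 ht.2
  · exact Filter.Eventually.of_forall (fun t => abs_nonneg _)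
  · exact (Continuous.intervalIntegrable (by fun_prop) _ _)

lemma ang_sum {p q : E2 → ℝ} (hp : ContDiff ℝ 1 p) (hq : ContDiff ℝ 1 q) (r : ℝ) :
    ang p r ^ 2 + ang q r ^ 2 ≤ 2 * π * en p q r := by
  have h0 := pd_cont hp 0
  have h1 := pd_cont hp 1
  have h2 := pd_cont hq 0
  have h3 := pd_cont hq 1
  have a := ang_sq hp r
  have b := ang_sq hq r
  have : en p q r = (∫ t in (0:ℝ)..(2 * π), (pd 0 p (cp r t) ^ 2 + pd 1 p (cp r t) ^ 2))
      + ∫ t in (0:ℝ)..(2 * π), (pd 0 q (cp r t) ^ 2 + pd 1 q (cp r t) ^ 2) := by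
    rw [← intervalIntegral.integral_add (Continuous.intervalIntegrable (by fun_prop) _ _)
      (Continuous.intervalIntegrable (by fun_prop) _ _)]
    unfold en D2
    congr 1; funext t; ring
  rw [this, mul_add]
  linarith

lemma pd_sub_const (f : E2 → ℝ) (c : ℝ) (i : Fin 2) : pd i (fun x => f x - c) = pd i f := by
  funext x; simp [pd, fderiv_sub_const]

lemma energy_ineq {p q : E2 → ℝ} (hp : ContDiff ℝ 1 p) (hq : ContDiff ℝ 1 q) {K R r : ℝ}
    (hK : 0 < K) (h : QR K p q R) (hr : 0 ≤ r) (hrR : r ≤ R) :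
    J r (D2 p q) ≤ π * K * r ^ 2 * en p q r := by
  have h0 := pd_cont hp 0
  have h1 := pd_cont hp 1
  have h2 := pd_cont hq 0
  have h3 := pd_cont hq 1
  have cc := hp.continuous
  have s1 : J r (D2 p q) ≤ -K * J r (fun x => pd 0 p x * pd 1 q x - pd 1 p x * pd 0 q x) := by
    rw [← J_smul]
    apply J_mono (D2_cont hp hq) (by fun_prop) hr
    intro x hx
    have := h x (hx.trans hrR)
    linarith
  have s2 := stokes (hp.sub (contDiff_const (c := p (cp r 0)))) hq r
  simp only [pd_sub_const] at s2
  rw [s2] at s1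
  have s3 : -(∫ t in (0:ℝ)..(2 * π), (p (cp r t) - p (cp r 0)) *
      (r * (-sin t * pd 0 q (cp r t) + cos t * pd 1 q (cp r t)))) ≤ r * ang p r * (r * ang q r) := by
    refine (neg_le_abs _).trans ((intervalIntegral.abs_integral_le_integral_abs two_pi_pos.le).trans ?_)
    rw [show ang q r = ∫ t in (0:ℝ)..(2 * π),
      |(-sin t * pd 0 q (cp r t) + cos t * pd 1 q (cp r t))| from rfl,
      ← intervalIntegral.integral_const_mul r, ← intervalIntegral.integral_const_mul]
    apply intervalIntegral.integral_mono_on two_pi_pos.le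
      (Continuous.intervalIntegrable (by fun_prop) _ _)
      (Continuous.intervalIntegrable (by fun_prop) _ _)
    intro t ht
    rw [abs_mul, abs_mul r, abs_of_nonneg hr]
    exact mul_le_mul_of_nonneg_right (osc_circle hp hr ht) (by positivity)
  have s4 := ang_sum hp hq r
  have s5 : r * ang p r * (r * ang q r) ≤ r ^ 2 * (π * en p q r) := by
    nlinarith [sq_nonneg (ang p r - ang q r), sq_nonneg r, mul_le_mul_of_nonneg_left s4 (sq_nonneg r),
      mul_nonneg (sq_nonneg r) (sq_nonneg (ang p r - ang q r))]
  have s6 := mul_le_mul_of_nonneg_left (s3.trans s5) hK.le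
  linarith

lemma decay {p q : E2 → ℝ} (hp : ContDiff ℝ 1 p) (hq : ContDiff ℝ 1 q) {K R r : ℝ}
    (hK : 0 < K) (h : QR K p q R) (hr : 0 < r) (hrR : r ≤ R) :
    J r (D2 p q) ≤ (r / R) ^ (1 / (π * K)) * J R (D2 p q) := by
  set β := 1 / (π * K) with hβ
  have hpk : 0 < π * K := by positivity
  have hR : 0 < R := hr.trans_le hrR
  have hder : ∀ s, 0 < s → HasDerivAt (fun s => s ^ (-β) * J s (D2 p q))
      ((-β * s ^ (-β - 1)) * J s (D2 p q) + s ^ (-β) * (s * en p q s)) s := by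
    intro s hs
    exact (Real.hasDerivAt_rpow_const (Or.inl hs.ne')).mul (J_hasDeriv hp hq s)
  have mono : MonotoneOn (fun s => s ^ (-β) * J s (D2 p q)) (Icc r R) := by
    apply monotoneOn_of_deriv_nonneg (convex_Icc r R)
    · intro s hs
      exact (hder s (hr.trans_le hs.1)).continuousAt.continuousWithinAt
    · intro s hs
      rw [interior_Icc] at hs
      exact (hder s (hr.trans hs.1)).differentiableAt.differentiableWithinAt
    · intro s hs
      rw [interior_Icc] at hs
      have hs0 := hr.trans hs.1
      rw [(hder s hs0).deriv]
      have e := energy_ineq hp hq hK h hs0.le hs.2.le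
      have e2 : β * J s (D2 p q) ≤ s ^ 2 * en p q s := by
        rw [hβ, one_div, inv_mul_le_iff₀ hpk]; linarith
      have e3 : s ^ (-β) = s ^ (-β - 1) * s := by
        rw [← Real.rpow_add_one hs0.ne']; congr 1; ring
      rw [e3]
      have e4 := Real.rpow_pos_of_pos hs0 (-β - 1)
      nlinarith [mul_le_mul_of_nonneg_left e2 e4.le]
  have m := mono (left_mem_Icc.2 hrR) (right_mem_Icc.2 hrR) hrR
  simp only at m
  rw [Real.div_rpow hr.le hR.le]
  rw [Real.rpow_neg hr.le, Real.rpow_neg hR.le] at m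
  have p1 := Real.rpow_pos_of_pos hr β
  have p2 := Real.rpow_pos_of_pos hR β
  rw [inv_mul_le_iff₀ p1] at m
  calc _ ≤ _ := m
    _ = _ := by ring

lemma J_zero {g : E2 → ℝ} (hg : Continuous g) {ρ : ℝ} (hn : ∀ x, ‖x‖ ≤ ρ → 0 ≤ g x)
    (hJ : J ρ g ≤ 0) {r t : ℝ} (hr : r ∈ Ioc 0 ρ) (ht : t ∈ Icc (0:ℝ) (2 * π)) :
    g (cp r t) = 0 := by
  by_contra hne
  have n0 : ∀ s ∈ Icc (0:ℝ) ρ, ∀ t, 0 ≤ s * g (cp s t) := fun s hs t =>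
    mul_nonneg hs.1 (hn _ (by rw [cp_norm, abs_of_nonneg hs.1]; exact hs.2))
  have : 0 < J ρ g := by
    unfold J
    apply intervalIntegral.integral_pos (hr.1.trans_le hr.2)
    · exact Continuous.continuousOn (by fun_prop)
    · intro s hs
      exact intervalIntegral.integral_nonneg two_pi_pos.le (fun t _ => n0 s ⟨hs.1.le, hs.2⟩ t)
    · refine ⟨r, ⟨hr.1.le, hr.2⟩, ?_⟩
      apply intervalIntegral.integral_pos two_pi_pos
      · exact Continuous.continuousOn (by fun_prop)
      · exact fun t _ => n0 r ⟨hr.1.le, hr.2⟩ t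
      · refine ⟨t, ht, lt_of_le_of_ne (n0 r ⟨hr.1.le, hr.2⟩ t) ?_⟩
        exact (mul_ne_zero hr.1.ne' hne).symm
  linarith

lemma max_principle {p q : E2 → ℝ} (hp : ContDiff ℝ 1 p) (hq : ContDiff ℝ 1 q) {K ρ : ℝ}
    (h : QR K p q ρ) (hρ : 0 ≤ ρ) {k : ℝ}
    (hk : ∀ t ∈ Icc (0:ℝ) (2 * π), p (cp ρ t) ≤ k) {x : E2} (hx : ‖x‖ ≤ ρ) : p x ≤ k := by
  have hST : ContDiff ℝ 1 Real.smoothTransition := Real.smoothTransition.contDiff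
  have dST := hST.differentiable (by norm_num)
  have mST : Monotone Real.smoothTransition := Real.smoothTransition.monotone
  set G : E2 → ℝ := fun x => Real.smoothTransition (p x - k) with hG
  have cG : ContDiff ℝ 1 G := hST.comp (hp.sub contDiff_const)
  set φ : E2 → ℝ := fun x => deriv Real.smoothTransition (p x - k) with hφ
  have cφ : Continuous φ := (hST.continuous_deriv (by norm_num)).comp (hp.continuous.sub continuous_const)
  have nφ : ∀ x, 0 ≤ φ x := fun x => mST.deriv_nonneg
  have pG : ∀ i x, pd i G x = φ x * pd i p x := by
    intro i x
    have h1 : HasFDerivAt (fun x => p x - k) (fderiv ℝ p x) x :=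
      ((hp.differentiable (by norm_num)) x).hasFDerivAt.sub_const k
    have h2 := (dST (p x - k)).hasDerivAt.comp_hasFDerivAt x h1
    have h3 : fderiv ℝ G x = φ x • fderiv ℝ p x := h2.fderiv
    simp [pd, h3]
  have G0 : ∀ t ∈ Icc (0:ℝ) (2 * π), G (cp ρ t) = 0 := fun t ht =>
    Real.smoothTransition.zero_of_nonpos (by linarith [hk t ht])
  have s := stokes cG hq ρ
  have s0 : ∫ t in (0:ℝ)..(2 * π), G (cp ρ t) *
        (ρ * (-sin t * pd 0 q (cp ρ t) + cos t * pd 1 q (cp ρ t))) = 0 := by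
    rw [intervalIntegral.integral_congr (g := fun _ => 0)]
    · simp
    · intro t ht
      rw [uIcc_of_le two_pi_pos.le] at ht
      simp [G0 t ht]
  rw [s0] at s
  have h0 := pd_cont hp 0
  have h1 := pd_cont hp 1
  have h2 := pd_cont hq 0
  have h3 := pd_cont hq 1
  have cD := D2_cont hp hq
  have g0 := pd_cont cG 0
  have g1 := pd_cont cG 1
  have JJ : J ρ (fun x => φ x * D2 p q x) ≤ 0 := by
    calc _ ≤ J ρ (fun x => -K * (pd 0 G x * pd 1 q x - pd 1 G x * pd 0 q x)) := by
          apply J_mono (by fun_prop) (by fun_prop) hρ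
          intro x hx
          rw [pG, pG]
          have := mul_le_mul_of_nonneg_left (h x hx) (nφ x)
          linarith
      _ = 0 := by rw [J_smul, s, mul_zero]
  have zero : ∀ r ∈ Ioc 0 ρ, ∀ t ∈ Icc (0:ℝ) (2 * π), ∀ i, pd i G (cp r t) = 0 := by
    intro r hr t ht i
    have := J_zero (by fun_prop) (fun x _ => mul_nonneg (nφ x) (D2_nonneg p q x)) JJ hr ht
    rw [pG]
    rcases mul_eq_zero.1 this with h | h
    · simp [h]
    · have : pd i p (cp r t) = 0 := by
        unfold D2 at h
        fin_cases i
        · simp only [Fin.zero_eta]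
          nlinarith [sq_nonneg (pd 0 p (cp r t)), sq_nonneg (pd 1 p (cp r t)), sq_nonneg (pd 0 q (cp r t)), sq_nonneg (pd 1 q (cp r t))]
        · simp only [Fin.mk_one]
          nlinarith [sq_nonneg (pd 0 p (cp r t)), sq_nonneg (pd 1 p (cp r t)), sq_nonneg (pd 0 q (cp r t)), sq_nonneg (pd 1 q (cp r t))]
      simp [this]
  obtain ⟨t, ht, hxt⟩ := cp_surj' x
  have dG := cG.differentiable (by norm_num)
  have mono : MonotoneOn (fun r => G (cp r t)) (Icc 0 ρ) := by
    apply monotoneOn_of_deriv_nonneg (convex_Icc 0 ρ)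
    · intro r _
      exact (cp_deriv_r dG r t).continuousAt.continuousWithinAt
    · intro r _
      exact (cp_deriv_r dG r t).differentiableAt.differentiableWithinAt
    · intro r hr
      rw [interior_Icc] at hr
      rw [(cp_deriv_r dG r t).deriv, zero r ⟨hr.1, hr.2.le⟩ t ht, zero r ⟨hr.1, hr.2.le⟩ t ht]
      simp
  have m := mono ⟨norm_nonneg x, hx⟩ ⟨hρ, le_rfl⟩ hx
  simp only [hxt, G0 t ht] at m
  by_contra hlt
  push Not at hlt
  have := Real.smoothTransition.pos_of_pos (x := p x - k) (by linarith)
  simp only [hG] at m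
  linarith

lemma pd_neg' (f : E2 → ℝ) (i : Fin 2) : pd i (fun x => -f x) = fun x => -pd i f x := by
  funext x; simp [pd, fderiv_fun_neg]

lemma QR_neg {K R : ℝ} {p q : E2 → ℝ} (h : QR K p q R) :
    QR K (fun x => -p x) (fun x => -q x) R := by
  intro x hx
  have := h x hx
  simp only [D2, pd_neg'] at this ⊢
  nlinarith

lemma QR_swap {K R : ℝ} {p q : E2 → ℝ} (h : QR K p q R) : QR K q (fun x => -p x) R := by
  intro x hx
  have := h x hx
  simp only [D2, pd_neg'] at this ⊢
  nlinarith

lemma QR_mono {K R r : ℝ} {p q : E2 → ℝ} (h : QR K p q R) (hr : r ≤ R) : QR K p q r :=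
  fun x hx => h x (hx.trans hr)

lemma D2_swap (p q : E2 → ℝ) : D2 q (fun x => -p x) = D2 p q := by
  funext x; simp only [D2, pd_neg']; ring

lemma holder_half {p q : E2 → ℝ} (hp : ContDiff ℝ 1 p) (hq : ContDiff ℝ 1 q) {K M : ℝ}
    (hK : 1 ≤ K) (hM : 0 ≤ M) (h : QR K p q (1 / 2)) (hE : J (1 / 2) (D2 p q) ≤ M ^ 2)
    {x : E2} (hx : ‖x‖ ≤ 1 / 4) : |p x - p 0| ≤ 32 * M * ‖x‖ ^ (1 / (2 * π * K)) := by
  rcases eq_or_ne x 0 with rfl | hx0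
  · simp only [sub_self, abs_zero]; positivity
  set r := ‖x‖ with hrdef
  have hr : 0 < r := norm_pos_iff.2 hx0
  have hK0 : 0 < K := by linarith
  obtain ⟨ρ, hρ, hρE⟩ := exists_hasDerivAt_eq_slope (fun R => J R (D2 p q))
    (fun R => R * en p q R) (show r < 2 * r by linarith)
    (fun s _ => (J_hasDeriv hp hq s).continuousAt.continuousWithinAt)
    (fun s _ => J_hasDeriv hp hq s)
  have hρ0 : 0 < ρ := hr.trans hρ.1
  have hρ2 : ρ ≤ 1 / 2 := by linarith [hρ.2]
  have E0 : 0 ≤ J r (D2 p q) := by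
    have := J_mono (g := fun _ => 0) continuous_const (D2_cont hp hq) hr.le (fun x _ => D2_nonneg p q x)
    rwa [J_const, mul_zero] at this
  have d := decay hp hq hK0 h (show 0 < 2 * r by linarith) (by linarith)
  rw [show 2 * r / (1 / 2) = 4 * r by ring] at d
  have d2 : J (2 * r) (D2 p q) ≤ (4 * r) ^ (1 / (π * K)) * M ^ 2 :=
    d.trans (mul_le_mul_of_nonneg_left hE (by positivity))
  have slope : ρ * en p q ρ * r ≤ (4 * r) ^ (1 / (π * K)) * M ^ 2 := by
    rw [hρE]
    rw [show 2 * r - r = r by ring, div_mul_cancel₀ _ hr.ne']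
    linarith
  set α := 1 / (2 * π * K) with hα
  have hα1 : α ≤ 1 := by
    rw [hα, div_le_one (by positivity)]
    nlinarith [pi_gt_three]
  have hα0 : 0 < α := by positivity
  have e1 : (4 * r) ^ (1 / (π * K)) = ((4 * r) ^ α) ^ 2 := by
    rw [← Real.rpow_natCast, ← Real.rpow_mul (by positivity)]
    congr 1; rw [hα]; push_cast; field_simp
  have e2 : (4 * r) ^ α ≤ 4 * r ^ α := by
    rw [Real.mul_rpow (by norm_num) hr.le]
    apply mul_le_mul_of_nonneg_right _ (by positivity)
    calc (4:ℝ) ^ α ≤ 4 ^ (1:ℝ) := Real.rpow_le_rpow_of_exponent_le (by norm_num) hα1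
      _ = 4 := by norm_num
  have hrα : 0 < r ^ α := Real.rpow_pos_of_pos hr _
  have e3 : (4 * r) ^ (1 / (π * K)) * M ^ 2 ≤ (4 * r ^ α * M) ^ 2 := by
    rw [e1, mul_pow _ M]
    apply mul_le_mul_of_nonneg_right _ (sq_nonneg M)
    exact pow_le_pow_left₀ (by positivity) e2 2
  have en0 : 0 ≤ en p q ρ :=
    intervalIntegral.integral_nonneg two_pi_pos.le (fun _ _ => D2_nonneg _ _ _)
  have e4 : ρ ^ 2 * en p q ρ ≤ 2 * (4 * r ^ α * M) ^ 2 := by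
    have : ρ ^ 2 * en p q ρ ≤ 2 * (ρ * en p q ρ * r) := by
      nlinarith [mul_nonneg (mul_nonneg hρ0.le en0) (show 0 ≤ 2 * r - ρ by linarith [hρ.2])]
    linarith
  have e5 : (ρ * ang p ρ) ^ 2 ≤ (16 * M * r ^ α) ^ 2 := by
    have s := ang_sum hp hq ρ
    have s2 : ang p ρ ^ 2 ≤ 8 * en p q ρ := by
      nlinarith [sq_nonneg (ang q ρ), mul_nonneg en0 (show 0 ≤ 4 - π by linarith [pi_lt_four])]
    have s3 := mul_le_mul_of_nonneg_left s2 (sq_nonneg ρ)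
    nlinarith
  have e6 : ρ * ang p ρ ≤ 16 * M * r ^ α := by
    have := abs_le_of_sq_le_sq e5 (by positivity)
    exact (le_abs_self _).trans this
  have osc : ∀ t ∈ Icc (0:ℝ) (2 * π), |p (cp ρ t) - p (cp ρ 0)| ≤ 16 * M * r ^ α :=
    fun t ht => (osc_circle hp hρ0.le ht).trans e6
  have up : ∀ y : E2, ‖y‖ ≤ ρ → p y ≤ p (cp ρ 0) + 16 * M * r ^ α := fun y hy =>
    max_principle hp hq (QR_mono h hρ2) hρ0.le
      (fun t ht => by linarith [(abs_le.1 (osc t ht)).2]) hy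
  have lo : ∀ y : E2, ‖y‖ ≤ ρ → -p y ≤ -p (cp ρ 0) + 16 * M * r ^ α := fun y hy =>
    max_principle hp.neg hq.neg (QR_neg (QR_mono h hρ2)) hρ0.le
      (fun t ht => by linarith [(abs_le.1 (osc t ht)).1]) hy
  have hxρ : ‖x‖ ≤ ρ := hρ.1.le
  have h0ρ : ‖(0:E2)‖ ≤ ρ := by simp [hρ0.le]
  rw [abs_le]
  constructor <;> linarith [up x hxρ, up 0 h0ρ, lo x hxρ, lo 0 h0ρ]

lemma pd_mul' {f g : E2 → ℝ} (hf : Differentiable ℝ f) (hg : Differentiable ℝ g) (i : Fin 2) (x : E2) :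
    pd i (fun x => f x * g x) x = pd i f x * g x + f x * pd i g x := by
  simp only [pd]
  rw [fderiv_fun_mul (hf x) (hg x)]
  simp; ring

lemma pd_coord (i j : Fin 2) (x : E2) : pd i (fun x : E2 => x j) x = if i = j then 1 else 0 := by
  have : fderiv ℝ (fun x : E2 => x j) x = (EuclideanSpace.proj j : E2 →L[ℝ] ℝ) :=
    (EuclideanSpace.proj j : E2 →L[ℝ] ℝ).hasFDerivAt.fderiv
  simp only [pd, this]
  simp [eq_comm]

lemma coord_contDiff (j : Fin 2) {n : WithTop ℕ∞} : ContDiff ℝ n (fun x : E2 => x j) :=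
  (EuclideanSpace.proj j : E2 →L[ℝ] ℝ).contDiff

def eta (x : E2) : ℝ := 1 - x 0 * x 0 - x 1 * x 1

lemma eta_contDiff {n : WithTop ℕ∞} : ContDiff ℝ n eta := by
  unfold eta
  exact (contDiff_const.sub ((coord_contDiff 0).mul (coord_contDiff 0))).sub
    ((coord_contDiff 1).mul (coord_contDiff 1))

lemma eta_pd (i : Fin 2) (x : E2) : pd i eta x = -2 * x i := by
  have d0 : Differentiable ℝ (fun x : E2 => x 0) := (coord_contDiff 0 (n := 1)).differentiable (by norm_num)
  have d1 : Differentiable ℝ (fun x : E2 => x 1) := (coord_contDiff 1 (n := 1)).differentiable (by norm_num)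
  have e : pd i eta x = - pd i (fun x : E2 => x 0 * x 0) x - pd i (fun x : E2 => x 1 * x 1) x := by
    unfold pd eta
    rw [fderiv_fun_sub (by fun_prop) (by fun_prop), fderiv_const_sub]
    simp
  rw [e, pd_mul' d0 d0, pd_mul' d1 d1, pd_coord, pd_coord]
  fin_cases i <;> simp <;> ring

lemma eta_cp (t : ℝ) : eta (cp 1 t) = 0 := by
  simp [eta, cp]; nlinarith [sin_sq_add_cos_sq t]

lemma eta_norm (x : E2) : eta x = 1 - ‖x‖ ^ 2 := by
  rw [EuclideanSpace.norm_sq_eq]; simp [Fin.sum_univ_two, eta]; ring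

lemma J_null {G q : E2 → ℝ} (hG : ContDiff ℝ 1 G) (hq : ContDiff ℝ 1 q) (R : ℝ)
    (h : ∀ t, G (cp R t) = 0) :
    J R (fun x => pd 0 G x * pd 1 q x - pd 1 G x * pd 0 q x) = 0 := by
  rw [stokes hG hq]; simp [h]

lemma pd_contDiff {w : E2 → ℝ} (hw : ContDiff ℝ 2 w) (i : Fin 2) : ContDiff ℝ 1 (pd i w) := by
  have : ContDiff ℝ 1 (fderiv ℝ w) := hw.fderiv_right (by norm_num)
  exact this.clm_apply contDiff_const

lemma pd_symm {w : E2 → ℝ} (hw : ContDiff ℝ 2 w) (x : E2) :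
    pd 1 (pd 0 w) x = pd 0 (pd 1 w) x := by
  have hd : Differentiable ℝ (fderiv ℝ w) :=
    ((hw.fderiv_right (m := 1) (by norm_num)).differentiable (by norm_num))
  have e : ∀ i j, pd i (pd j w) x = fderiv ℝ (fderiv ℝ w) x (EuclideanSpace.single i 1) (EuclideanSpace.single j 1) := by
    intro i j
    unfold pd
    rw [fderiv_clm_apply (hd x) (differentiableAt_const _)]
    simp
  rw [e, e]
  exact (hw.contDiffAt (x := x)).isSymmSndFDerivAt (by simp) _ _

lemma J_mono_R {g : E2 → ℝ} (hg : Continuous g) (hn : ∀ x, 0 ≤ g x) {r R : ℝ} (hr : 0 ≤ r)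
    (hR : r ≤ R) : J r g ≤ J R g := by
  unfold J
  rw [← intervalIntegral.integral_add_adjacent_intervals (a := 0) (b := r) (c := R)
    (Continuous.intervalIntegrable (by fun_prop) _ _)
    (Continuous.intervalIntegrable (by fun_prop) _ _)]
  have : 0 ≤ ∫ s in r..R, ∫ t in (0:ℝ)..(2 * π), s * g (cp s t) :=
    intervalIntegral.integral_nonneg hR (fun s hs =>
      intervalIntegral.integral_nonneg two_pi_pos.le (fun t _ => mul_nonneg (hr.trans hs.1) (hn _)))
  linarith

lemma caccioppoli {w : E2 → ℝ} (hw : ContDiff ℝ 2 w) {K S : ℝ} (hK : 1 ≤ K)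
    (h : QR K (pd 0 w) (pd 1 w) 1) (hS : ∀ x, ‖x‖ ≤ 1 → |w x| ≤ S) :
    J (1 / 2) (D2 (pd 0 w) (pd 1 w)) ≤ (1000 * K ^ 2 * S) ^ 2 := by
  set p := pd 0 w with hp'
  set q := pd 1 w with hq'
  have hp : ContDiff ℝ 1 p := pd_contDiff hw 0
  have hq : ContDiff ℝ 1 q := pd_contDiff hw 1
  have hw1 : ContDiff ℝ 1 w := hw.of_le (by norm_num)
  have hsym : ∀ x, pd 1 p x = pd 0 q x := pd_symm hw
  have hη : ContDiff ℝ 1 eta := eta_contDiff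
  have dw := hw1.differentiable (by norm_num)
  have dp := hp.differentiable (by norm_num)
  have dq := hq.differentiable (by norm_num)
  have dη := hη.differentiable (by norm_num)
  have cw := hw1.continuous
  have cp' := hp.continuous
  have cq' := hq.continuous
  have cη := hη.continuous
  have c0 : Continuous fun x : E2 => x 0 := (coord_contDiff 0 (n := 1)).continuous
  have c1 : Continuous fun x : E2 => x 1 := (coord_contDiff 1 (n := 1)).continuous
  have h0 := pd_cont hp 0
  have h1 := pd_cont hp 1
  have h2 := pd_cont hq 0
  have h3 := pd_cont hq 1
  have cD := D2_cont hp hq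
  have hη2 : ContDiff ℝ 1 (fun x => eta x * eta x) := hη.mul hη
  have dη2 := hη2.differentiable (by norm_num)
  have hη4 : ContDiff ℝ 1 (fun x => (eta x * eta x) * (eta x * eta x)) := hη2.mul hη2
  have dη4 := hη4.differentiable (by norm_num)
  -- first null Lagrangian identity
  have N1 := J_null (hη4.mul hp) hq 1 (fun t => by simp [eta_cp])
  have N2 := J_null ((hη2.mul hw1).mul hp) (coord_contDiff 1) 1 (fun t => by simp [eta_cp])
  have N3 := J_null ((hη2.mul hw1).mul hq) (coord_contDiff 0) 1 (fun t => by simp [eta_cp])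
  have dηηw := (hη2.mul hw1).differentiable (by norm_num)
  have E1 : ∀ x i, pd i (fun x => (eta x * eta x) * (eta x * eta x) * p x) x
      = -8 * eta x ^ 3 * x i * p x + eta x ^ 4 * pd i p x := by
    intro x i
    rw [pd_mul' dη4 dp, pd_mul' dη2 dη2, pd_mul' dη dη, eta_pd]; ring
  have E2' : ∀ x i, ∀ f : E2 → ℝ, Differentiable ℝ f → pd i (fun x => (eta x * eta x) * w x * f x) x
      = -4 * eta x * x i * w x * f x + eta x ^ 2 * pd i w x * f x + eta x ^ 2 * w x * pd i f x := by
    intro x i f df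
    rw [pd_mul' dηηw df, pd_mul' dη2 dw, pd_mul' dη dη, eta_pd]; ring
  simp only [E1] at N1
  simp only [E2' _ _ _ dp, pd_coord] at N2
  simp only [E2' _ _ _ dq, pd_coord] at N3
  simp only [if_true, if_false, Fin.zero_eq_one_iff, Fin.one_eq_zero_iff, OfNat.ofNat_ne_one, mul_one, mul_zero, sub_zero, zero_sub] at N2 N3
  set T2 := J 1 (fun x => eta x ^ 4 * D2 p q x) with hT2
  set T1 := J 1 (fun x => eta x ^ 2 * (p x ^ 2 + q x ^ 2)) with hT1
  set T0 := J 1 (fun x => w x ^ 2) with hT0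
  have hK0 : 0 < K := by linarith
  have hB : ∀ x : E2, ‖x‖ ≤ 1 → 0 ≤ eta x ∧ x 0 ^ 2 + x 1 ^ 2 ≤ 1 := by
    intro x hx
    have e := eta_norm x
    have : ‖x‖ ^ 2 ≤ 1 := by nlinarith [norm_nonneg x]
    refine ⟨by linarith, ?_⟩
    unfold eta at e; nlinarith
  have I1 : T2 ≤ (-K) * 0 + ((1 / 2) * T2 + 32 * K ^ 2 * T1) := by
    rw [← N1, hT2, hT1, ← J_smul, ← J_smul, ← J_smul, ← J_add (by fun_prop) (by fun_prop),
      ← J_add (by fun_prop) (by fun_prop)]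
    apply J_mono (by fun_prop) (by fun_prop) zero_le_one
    intro x hx
    obtain ⟨b1, b2⟩ := hB x hx
    have hh := mul_le_mul_of_nonneg_left (h x hx) (by positivity : 0 ≤ eta x ^ 4)
    set m := x 0 * pd 1 q x - x 1 * pd 0 q x with hm
    have hm2 : m ^ 2 ≤ D2 p q x := by
      have a1 : m ^ 2 ≤ (x 0 ^ 2 + x 1 ^ 2) * (pd 0 q x ^ 2 + pd 1 q x ^ 2) := by
        rw [hm]; nlinarith [sq_nonneg (x 0 * pd 0 q x + x 1 * pd 1 q x)]
      have a2 : (x 0 ^ 2 + x 1 ^ 2) * (pd 0 q x ^ 2 + pd 1 q x ^ 2) ≤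
          1 * (pd 0 q x ^ 2 + pd 1 q x ^ 2) := mul_le_mul_of_nonneg_right b2 (by positivity)
      unfold D2; nlinarith [sq_nonneg (pd 0 p x), sq_nonneg (pd 1 p x)]
    have hm3 := mul_le_mul_of_nonneg_left hm2 (by positivity : 0 ≤ eta x ^ 4)
    have sq1 := sq_nonneg (eta x ^ 2 * m + 8 * K * eta x * p x)
    have sq2 : 0 ≤ 32 * K ^ 2 * (eta x ^ 2 * q x ^ 2) := by positivity
    have expand : (eta x ^ 2 * m + 8 * K * eta x * p x) ^ 2 = eta x ^ 4 * m ^ 2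
      + 16 * K * eta x ^ 3 * p x * m + 64 * K ^ 2 * (eta x ^ 2 * p x ^ 2) := by ring
    have e8 : 16 * K * eta x ^ 3 * p x * m = 16 * K * eta x ^ 3 * p x * (x 0 * pd 1 q x - x 1 * pd 0 q x) := by rw [hm]
    linarith
  have cp'' : Continuous (pd 0 w) := cp'
  have cq'' : Continuous (pd 1 w) := cq'
  have I2 : T1 ≤ (J 1 fun x => -4 * eta x * x 0 * w x * p x + eta x ^ 2 * pd 0 w x * p x
        + eta x ^ 2 * w x * pd 0 p x) +
      ((-1) * (J 1 fun x => -(-4 * eta x * x 1 * w x * q x + eta x ^ 2 * pd 1 w x * q x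
        + eta x ^ 2 * w x * pd 1 q x)) + ((1 / 2) * T1 + ((1 / (256 * K ^ 2)) * T2 + (8 + 128 * K ^ 2) * T0))) := by
    rw [hT2, hT1, hT0, ← J_smul, ← J_smul, ← J_smul, ← J_smul, ← J_add (by fun_prop) (by fun_prop),
      ← J_add (by fun_prop) (by fun_prop), ← J_add (by fun_prop) (by fun_prop),
      ← J_add (by fun_prop) (by fun_prop)]
    apply J_mono (by fun_prop) (by fun_prop) zero_le_one
    intro x hx
    obtain ⟨b1, b2⟩ := hB x hx
    set m := x 0 * p x + x 1 * q x with hm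
    set l := pd 0 p x + pd 1 q x with hl
    have hm2 : m ^ 2 ≤ p x ^ 2 + q x ^ 2 := by
      have a1 : m ^ 2 ≤ (x 0 ^ 2 + x 1 ^ 2) * (p x ^ 2 + q x ^ 2) := by
        rw [hm]; nlinarith [sq_nonneg (x 0 * q x - x 1 * p x)]
      have a2 : (x 0 ^ 2 + x 1 ^ 2) * (p x ^ 2 + q x ^ 2) ≤
          1 * (p x ^ 2 + q x ^ 2) := mul_le_mul_of_nonneg_right b2 (by positivity)
      linarith
    have hl2 : l ^ 2 ≤ 2 * D2 p q x := by
      rw [hl]; unfold D2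
      nlinarith [sq_nonneg (pd 0 p x - pd 1 q x), sq_nonneg (pd 1 p x), sq_nonneg (pd 0 q x)]
    have hm3 := mul_le_mul_of_nonneg_left hm2 (by positivity : 0 ≤ eta x ^ 2)
    have hl3 := mul_le_mul_of_nonneg_left hl2 (by positivity : 0 ≤ 1 / (512 * K ^ 2) * eta x ^ 4)
    have sq1 := sq_nonneg (eta x * m - 4 * w x)
    have sq2 := sq_nonneg (eta x ^ 2 * l / (K * 16) + 16 * K * w x)
    have ex1 : (eta x * m - 4 * w x) ^ 2 = eta x ^ 2 * m ^ 2 - 8 * eta x * w x * (x 0 * p x + x 1 * q x)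
      + 16 * w x ^ 2 := by rw [hm]; ring
    have ex2 : (eta x ^ 2 * l / (K * 16) + 16 * K * w x) ^ 2 = 2 * (1 / (512 * K ^ 2) * eta x ^ 4 * l ^ 2)
      + 2 * eta x ^ 2 * w x * (pd 0 p x + pd 1 q x) + 256 * K ^ 2 * w x ^ 2 := by
      rw [hl]; field_simp; ring
    have ex3 : 1 / (512 * K ^ 2) * eta x ^ 4 * (2 * D2 p q x)
      = 1 / (256 * K ^ 2) * (eta x ^ 4 * D2 p q x) := by field_simp; ring
    simp only [← hp', ← hq']
    linarith
  rw [N2, N3] at I2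
  have T0le : T0 ≤ 4 * S ^ 2 := by
    have : T0 ≤ J 1 (fun _ => S ^ 2) := by
      apply J_mono (by fun_prop) continuous_const zero_le_one
      intro x hx
      exact sq_le_sq' (by linarith [(abs_le.1 (hS x hx)).1]) (abs_le.1 (hS x hx)).2
    rw [J_const] at this
    nlinarith [sq_nonneg S, pi_lt_four]
  have I3 : T2 ≤ 64 * K ^ 2 * T1 := by linarith
  have I4 : 64 * K ^ 2 * T1 ≤ (1 / 2) * T2 + 64 * K ^ 2 * (16 + 256 * K ^ 2) * T0 := by
    have : T1 ≤ (1 / (128 * K ^ 2)) * T2 + (16 + 256 * K ^ 2) * T0 := by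
      have : 1 / (128 * K ^ 2) * T2 = 2 * (1 / (256 * K ^ 2) * T2) := by field_simp; ring
      rw [this]; linarith
    have t := mul_le_mul_of_nonneg_left this (by positivity : 0 ≤ 64 * K ^ 2)
    have e : 64 * K ^ 2 * ((1 / (128 * K ^ 2)) * T2 + (16 + 256 * K ^ 2) * T0)
      = (1 / 2) * T2 + 64 * K ^ 2 * (16 + 256 * K ^ 2) * T0 := by field_simp; ring
    linarith
  have I5 : T2 ≤ 128 * K ^ 2 * (16 + 256 * K ^ 2) * (4 * S ^ 2) := by
    have := mul_le_mul_of_nonneg_left T0le (by positivity : 0 ≤ 128 * K ^ 2 * (16 + 256 * K ^ 2))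
    linarith
  have I6 : J (1 / 2) (D2 p q) ≤ 4 * T2 := by
    calc J (1 / 2) (D2 p q) ≤ J (1 / 2) (fun x => 4 * (eta x ^ 4 * D2 p q x)) := by
          apply J_mono cD (by fun_prop) (by norm_num)
          intro x hx
          have e : 3 / 4 ≤ eta x := by rw [eta_norm]; nlinarith [norm_nonneg x]
          have e4 : (3 / 4 : ℝ) ^ 4 ≤ eta x ^ 4 := pow_le_pow_left₀ (by norm_num) e 4
          nlinarith [D2_nonneg p q x, mul_le_mul_of_nonneg_right e4 (D2_nonneg p q x)]
      _ ≤ J 1 (fun x => 4 * (eta x ^ 4 * D2 p q x)) :=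
          J_mono_R (by fun_prop) (fun x => by have := D2_nonneg p q x; positivity) (by norm_num) (by norm_num)
      _ = 4 * T2 := J_smul _ _ _
  have hKK : K ^ 2 ≤ K ^ 4 := pow_le_pow_right₀ hK (by norm_num)
  have I7 : 128 * K ^ 2 * (16 + 256 * K ^ 2) ≤ 34816 * K ^ 4 := by nlinarith
  nlinarith [mul_le_mul_of_nonneg_right I7 (sq_nonneg S), sq_nonneg S, mul_nonneg (by positivity : 0 ≤ K ^ 4) (sq_nonneg S)]

def aK (K : ℝ) : ℝ := 1 / (2 * π * K)

lemma pd_line {w : E2 → ℝ} (hw : Differentiable ℝ w) (y : E2) (i : Fin 2) (t : ℝ) :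
    HasDerivAt (fun t : ℝ => w (y + t • (EuclideanSpace.single i 1 : E2)))
      (pd i w (y + t • (EuclideanSpace.single i 1 : E2))) t := by
  have h1 : HasDerivAt (fun t : ℝ => y + t • (EuclideanSpace.single i 1 : E2))
      (EuclideanSpace.single i 1 : E2) t := by
    have := ((hasDerivAt_id t).smul_const (EuclideanSpace.single i 1 : E2)).const_add y
    simp only [one_smul] at this
    exact this
  exact (hw _).hasFDerivAt.comp_hasDerivAt t h1

lemma single_norm (i : Fin 2) : ‖(EuclideanSpace.single i 1 : E2)‖ = 1 := by simp

lemma unit_est {w : E2 → ℝ} (hw : ContDiff ℝ 2 w) {K S : ℝ} (hK : 1 ≤ K)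
    (h : QR K (pd 0 w) (pd 1 w) 1) (hS : ∀ x, ‖x‖ ≤ 1 → |w x| ≤ S) (i : Fin 2) :
    |pd i w 0| ≤ 40000 * K ^ 2 * S ∧
    ∀ x : E2, ‖x‖ ≤ 1 / 4 → |pd i w x - pd i w 0| ≤ 40000 * K ^ 2 * S * ‖x‖ ^ aK K := by
  have hS0 : 0 ≤ S := (abs_nonneg _).trans (hS 0 (by simp))
  have hM : 0 ≤ 1000 * K ^ 2 * S := by positivity
  have hc := caccioppoli hw hK h hS
  have hK2 : 1 ≤ K ^ 2 := one_le_pow₀ hK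
  have hol : ∀ x : E2, ‖x‖ ≤ 1 / 4 →
      |pd i w x - pd i w 0| ≤ 32 * (1000 * K ^ 2 * S) * ‖x‖ ^ aK K := by
    intro x hx
    have h' := QR_mono h (show (1/2 : ℝ) ≤ 1 by norm_num)
    fin_cases i
    · exact holder_half (pd_contDiff hw 0) (pd_contDiff hw 1) hK hM h' hc hx
    · refine holder_half (pd_contDiff hw 1) (pd_contDiff hw 0).neg hK hM (QR_swap h') ?_ hx
      have e := D2_swap (pd 0 w) (pd 1 w)
      rw [← e] at hc
      exact hc
  refine ⟨?_, fun x hx => (hol x hx).trans ?_⟩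
  · have dw := hw.differentiable (by norm_num)
    obtain ⟨s, hs, hs'⟩ := exists_hasDerivAt_eq_slope
      (fun t : ℝ => w (0 + t • (EuclideanSpace.single i 1 : E2)))
      (fun t : ℝ => pd i w (0 + t • (EuclideanSpace.single i 1 : E2))) (show (0:ℝ) < 1 / 4 by norm_num)
      (fun t _ => (pd_line dw 0 i t).continuousAt.continuousWithinAt)
      (fun t _ => pd_line dw 0 i t)
    simp only [zero_add, zero_smul, sub_zero] at hs'
    have n1 : ‖s • (EuclideanSpace.single i 1 : E2)‖ ≤ 1 / 4 := by
      rw [norm_smul, single_norm, mul_one, Real.norm_eq_abs, abs_of_pos hs.1]; exact hs.2.le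
    have n2 : ‖(1 / 4 : ℝ) • (EuclideanSpace.single i 1 : E2)‖ ≤ 1 := by
      rw [norm_smul, single_norm]; norm_num
    have a1 := hS _ n2
    have a2 := hS 0 (by simp)
    have a3 := hol _ n1
    have a4 : ‖s • (EuclideanSpace.single i 1 : E2)‖ ^ aK K ≤ 1 := by
      apply Real.rpow_le_one (norm_nonneg _) (by linarith)
      unfold aK; positivity
    have a5 : |pd i w (s • (EuclideanSpace.single i 1 : E2))| ≤ 8 * S := by
      rw [hs', div_eq_mul_inv]
      rw [abs_le] at a1 a2 ⊢
      constructor <;> linarith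
    have a6 : 32 * (1000 * K ^ 2 * S) * ‖s • (EuclideanSpace.single i 1 : E2)‖ ^ aK K
        ≤ 32 * (1000 * K ^ 2 * S) := mul_le_of_le_one_right (by positivity) a4
    have a7 : S ≤ K ^ 2 * S := le_mul_of_one_le_left hS0 hK2
    rw [abs_le] at a3 a5 ⊢
    constructor <;> linarith
  · apply mul_le_mul_of_nonneg_right _ (by positivity)
    nlinarith

/-- pointwise ellipticity of the Hessian -/
def EL (K : ℝ) (w : E2 → ℝ) (x : E2) : Prop :=
  D2 (pd 0 w) (pd 1 w) x ≤
    K * (pd 1 (pd 0 w) x * pd 0 (pd 1 w) x - pd 0 (pd 0 w) x * pd 1 (pd 1 w) x)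

lemma pd_scale {w : E2 → ℝ} (hw : Differentiable ℝ w) (y : E2) (R : ℝ) (i : Fin 2) :
    pd i (fun z => w (y + R • z)) = fun z => R * pd i w (y + R • z) := by
  funext z
  have h1 : HasFDerivAt (fun z : E2 => y + R • z) (R • ContinuousLinearMap.id ℝ E2) z :=
    ((hasFDerivAt_id z).const_smul R).const_add y
  have := ((hw (y + R • z)).hasFDerivAt.comp z h1).fderiv
  unfold pd
  have e : fderiv ℝ (fun z => w (y + R • z)) z = (fderiv ℝ w (y + R • z)).comp (R • ContinuousLinearMap.id ℝ E2) := this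
  rw [e]; simp

lemma pd_const_mul {f : E2 → ℝ} (hf : Differentiable ℝ f) (c : ℝ) (i : Fin 2) :
    pd i (fun x => c * f x) = fun x => c * pd i f x := by
  funext x; unfold pd; rw [fderiv_const_mul (hf x)]; simp

lemma scaled_est {w : E2 → ℝ} (hw : ContDiff ℝ 2 w) {K S R : ℝ} {y : E2} (hK : 1 ≤ K) (hR : 0 < R)
    (h : ∀ x, ‖x - y‖ ≤ R → EL K w x) (hS : ∀ x, ‖x - y‖ ≤ R → |w x| ≤ S) (i : Fin 2) :
    |pd i w y| ≤ 40000 * K ^ 2 * S / R ∧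
    ∀ x : E2, ‖x - y‖ ≤ R / 4 →
      |pd i w x - pd i w y| ≤ 40000 * K ^ 2 * S / R * (‖x - y‖ / R) ^ aK K := by
  set u : E2 → ℝ := fun z => w (y + R • z) with hu
  have cu : ContDiff ℝ 2 u := hw.comp (contDiff_const.add (contDiff_id.const_smul R))
  have dw := hw.differentiable (by norm_num)
  have dpw := fun i => (pd_contDiff hw i).differentiable (by norm_num)
  have p1 : ∀ i, pd i u = fun z => R * pd i w (y + R • z) := pd_scale dw y R
  have p2 : ∀ i j z, pd j (pd i u) z = R ^ 2 * pd j (pd i w) (y + R • z) := by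
    intro i j z
    have dd : Differentiable ℝ (fun z : E2 => pd i w (y + R • z)) :=
      (dpw i).comp (f := fun z : E2 => y + R • z) (by fun_prop)
    rw [p1, pd_const_mul dd, pd_scale (dpw i)]
    ring
  have nz : ∀ z : E2, ‖z‖ ≤ 1 → ‖y + R • z - y‖ ≤ R := by
    intro z hz
    rw [add_sub_cancel_left, norm_smul, Real.norm_eq_abs, abs_of_pos hR]
    exact mul_le_of_le_one_right hR.le hz
  have hq : QR K (pd 0 u) (pd 1 u) 1 := by
    intro z hz
    have := h _ (nz z hz)
    unfold EL at this
    simp only [D2, p2] at this ⊢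
    have := mul_le_mul_of_nonneg_left this (by positivity : 0 ≤ R ^ 4)
    linarith
  obtain ⟨a, b⟩ := unit_est cu hK hq (fun z hz => hS _ (nz z hz)) i
  rw [p1] at a b
  simp only [smul_zero, add_zero] at a b
  refine ⟨?_, ?_⟩
  · rw [abs_mul, abs_of_pos hR] at a
    rw [le_div_iff₀ hR]; linarith
  · intro x hx
    have e : y + R • (R⁻¹ • (x - y)) = x := by rw [smul_inv_smul₀ hR.ne']; abel
    have n : ‖R⁻¹ • (x - y)‖ = ‖x - y‖ / R := by
      rw [norm_smul, Real.norm_eq_abs, abs_of_pos (inv_pos.2 hR)]; ring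
    have := b (R⁻¹ • (x - y)) (by rw [n, div_le_iff₀ hR]; linarith)
    rw [e, n, ← mul_sub, abs_mul, abs_of_pos hR] at this
    rw [div_mul_eq_mul_div, le_div_iff₀ hR]; linarith

lemma eig_arith {lam Lam a b : ℝ} (hlam : 0 < lam)
    (h1 : 0 ≤ Lam * (max a 0 + max b 0) - lam * (max (-a) 0 + max (-b) 0))
    (h2 : 0 ≤ Lam * (max (-a) 0 + max (-b) 0) - lam * (max a 0 + max b 0)) :
    a ^ 2 + b ^ 2 ≤ 2 * Lam / lam * (-(a * b)) := by
  rw [div_mul_eq_mul_div, le_div_iff₀ hlam]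
  rcases le_total a 0 with ha | ha <;> rcases le_total b 0 with hb | hb
  · rw [max_eq_right ha, max_eq_right hb, max_eq_left (neg_nonneg.2 ha), max_eq_left (neg_nonneg.2 hb)] at h1 h2
    have : a = 0 := by nlinarith
    have : b = 0 := by nlinarith
    subst a b; simp
  · rw [max_eq_right ha, max_eq_left hb, max_eq_left (neg_nonneg.2 ha), max_eq_right (neg_nonpos.2 hb)] at h1 h2
    nlinarith
  · rw [max_eq_left ha, max_eq_right hb, max_eq_right (neg_nonpos.2 ha), max_eq_left (neg_nonneg.2 hb)] at h1 h2
    nlinarith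
  · rw [max_eq_left ha, max_eq_left hb, max_eq_right (neg_nonpos.2 ha), max_eq_right (neg_nonpos.2 hb)] at h1 h2
    have : a = 0 := by nlinarith
    have : b = 0 := by nlinarith
    subst a b; simp

lemma ell_alg {lam Lam : ℝ} (hlam : 0 < lam) {F : Mat2 → ℝ} (hF : UniformlyElliptic lam Lam F)
    {M N : Mat2} (hM : M.IsHermitian) (hN : N.IsHermitian) (e : F M = F N) :
    (M - N) 0 0 ^ 2 + (M - N) 0 1 ^ 2 + (M - N) 1 0 ^ 2 + (M - N) 1 1 ^ 2 ≤
      2 * Lam / lam * ((M - N) 0 1 * (M - N) 1 0 - (M - N) 0 0 * (M - N) 1 1) := by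
  have k1 := hF M N hM hN
  have k2 := hF N M hN hM
  rw [e, sub_self] at k1
  rw [e, sub_self] at k2
  have hA : (M - N).IsHermitian := hM.sub hN
  have hB : (N - M).IsHermitian := hN.sub hM
  simp only [posNorm, negNorm, hA, hB, dif_pos, Fin.sum_univ_two] at k1 k2
  have tA := hA.trace_eq_sum_eigenvalues
  have tB := hB.trace_eq_sum_eigenvalues
  have dA := hA.det_eq_prod_eigenvalues
  have dB := hB.det_eq_prod_eigenvalues
  have sA := hA.apply 0 1
  simp only [Fin.sum_univ_two, Fin.prod_univ_two, Matrix.det_fin_two, Matrix.trace_fin_two,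
    Matrix.sub_apply, RCLike.ofReal_real_eq_id, id, star_trivial] at tA tB dA dB sA ⊢
  generalize hA.eigenvalues 0 = a at *
  generalize hA.eigenvalues 1 = b at *
  generalize hB.eigenvalues 0 = c at *
  generalize hB.eigenvalues 1 = d at *
  have sum : c + d = -(a + b) := by linarith
  have prod : c * d = a * b := by rw [← dA, ← dB]; ring
  have hz : (c + a) * (c + b) = 0 := by linear_combination c * sum - prod
  have concl : a ^ 2 + b ^ 2 ≤ 2 * Lam / lam * (-(a * b)) := by
    rcases mul_eq_zero.1 hz with h | h
    · have h1 : c = -a := by linarith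
      have h2 : d = -b := by linarith
      rw [h1, h2] at k2
      exact eig_arith hlam k1 (by simpa using k2)
    · have h1 : c = -b := by linarith
      have h2 : d = -a := by linarith
      rw [h1, h2] at k2
      exact eig_arith hlam k1 (by simp only [neg_neg] at k2; linarith)
  have l : (M 0 0 - N 0 0) ^ 2 + (M 0 1 - N 0 1) ^ 2 + (M 1 0 - N 1 0) ^ 2 + (M 1 1 - N 1 1) ^ 2
      = a ^ 2 + b ^ 2 := by
    rw [sA] at *
    have : a ^ 2 + b ^ 2 = (a + b) ^ 2 - 2 * (a * b) := by ring
    rw [this, ← tA, ← dA]; ring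
  rw [l]
  have r : (M 0 1 - N 0 1) * (M 1 0 - N 1 0) - (M 0 0 - N 0 0) * (M 1 1 - N 1 1) = -(a * b) := by
    rw [← dA]; ring
  rw [r]; exact concl


lemma pd_dq {V : E2 → ℝ} (hV : Differentiable ℝ V) (c : ℝ) (h : E2) (j : Fin 2) :
    pd j (fun x => c * (V (x + h) - V x)) = fun x => c * (pd j V (x + h) - pd j V x) := by
  have d1 : Differentiable ℝ (fun x => V (x + h)) := hV.comp (by fun_prop)
  rw [pd_const_mul (d1.fun_sub hV)]
  funext x
  unfold pd
  have : fderiv ℝ (fun x => V (x + h) - V x) x = fderiv ℝ V (x + h) - fderiv ℝ V x := by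
    have e := fderiv_fun_sub (d1 x) (hV x)
    rw [e, fderiv_comp_add_right]
  rw [this]; simp

lemma hess_herm {V : E2 → ℝ} (hV : ContDiff ℝ 2 V) (x : E2) : (hess V x).IsHermitian := by
  have := pd_symm hV x
  refine Matrix.IsHermitian.ext fun i j => ?_
  fin_cases i <;> fin_cases j
  · rfl
  · exact this
  · exact this.symm
  · rfl

lemma EL_of_alg {V : E2 → ℝ} {K : ℝ} {x : E2} {A : Mat2} {c : ℝ}
    (h : A 0 0 ^ 2 + A 0 1 ^ 2 + A 1 0 ^ 2 + A 1 1 ^ 2 ≤ K * (A 0 1 * A 1 0 - A 0 0 * A 1 1))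
    (e : ∀ i j, pd i (pd j V) x = c * A i j) : EL K V x := by
  unfold EL D2
  simp only [e]
  have := mul_le_mul_of_nonneg_left h (sq_nonneg c)
  linarith

lemma dir_deriv {f : E2 → ℝ} (hf : Differentiable ℝ f) (y z : E2) (t : ℝ) :
    HasDerivAt (fun t : ℝ => f (y + t • z)) (z 0 * pd 0 f (y + t • z) + z 1 * pd 1 f (y + t • z)) t := by
  have h1 : HasDerivAt (fun t : ℝ => y + t • z) z t := by
    simpa using ((hasDerivAt_id t).smul_const z).const_add y
  have h2 := (hf (y + t • z)).hasFDerivAt.comp_hasDerivAt t h1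
  have e : z = z 0 • EuclideanSpace.single 0 1 + z 1 • EuclideanSpace.single 1 1 := by
    ext i; fin_cases i <;> simp
  have : fderiv ℝ f (y + t • z) z = z 0 * pd 0 f (y + t • z) + z 1 * pd 1 f (y + t • z) := by
    conv_lhs => rw [e]
    rw [map_add, map_smul, map_smul]
    simp only [pd, smul_eq_mul]
    rw [← e]
  rw [← this]; exact h2

lemma taylor1 {g g' g'' : ℝ → ℝ} {B : ℝ} (h1 : ∀ t, HasDerivAt g (g' t) t)
    (h2 : ∀ t, HasDerivAt g' (g'' t) t) (hB : ∀ t ∈ Icc (0:ℝ) 1, |g'' t| ≤ B)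
    (z0 : g 0 = 0) (z1 : g' 0 = 0) : |g 1| ≤ B := by
  have hB0 : 0 ≤ B := (abs_nonneg _).trans (hB 0 (by simp))
  have s1 : ∀ t ∈ Icc (0:ℝ) 1, |g' t| ≤ B := by
    intro t ht
    have := (convex_Icc (0:ℝ) 1).norm_image_sub_le_of_norm_hasDerivWithin_le
      (fun x _ => (h2 x).hasDerivWithinAt) hB (by simp : (0:ℝ) ∈ Icc (0:ℝ) 1) ht
    rw [z1, sub_zero, sub_zero, Real.norm_eq_abs, Real.norm_eq_abs, abs_of_nonneg ht.1] at this
    exact this.trans (mul_le_of_le_one_right hB0 ht.2)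
  have := (convex_Icc (0:ℝ) 1).norm_image_sub_le_of_norm_hasDerivWithin_le
      (fun x _ => (h1 x).hasDerivWithinAt) s1 (by simp : (0:ℝ) ∈ Icc (0:ℝ) 1) (by simp : (1:ℝ) ∈ Icc (0:ℝ) 1)
  simpa [z0] using this

def T2 (V : E2 → ℝ) (y z : E2) : ℝ :=
  V y + (z 0 * pd 0 V y + z 1 * pd 1 V y) +
    1 / 2 * (z 0 * (z 0 * pd 0 (pd 0 V) y + z 1 * pd 1 (pd 0 V) y)
      + z 1 * (z 0 * pd 0 (pd 1 V) y + z 1 * pd 1 (pd 1 V) y))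

lemma quad_bd {a b c d p q B n : ℝ} (hp : |p| ≤ n) (hq : |q| ≤ n) (ha : |a| ≤ B) (hb : |b| ≤ B)
    (hc : |c| ≤ B) (hd : |d| ≤ B) :
    |p * (p * a + q * b) + q * (p * c + q * d)| ≤ 4 * n ^ 2 * B := by
  have key : ∀ {s t e : ℝ}, |s| ≤ n → |t| ≤ n → |e| ≤ B → |s * t * e| ≤ n ^ 2 * B := by
    intro s t e hs ht he
    have hn : 0 ≤ n := (abs_nonneg _).trans hs
    rw [abs_mul, abs_mul, sq]
    gcongr
  have h1 := abs_le.1 (key hp hp ha)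
  have h2 := abs_le.1 (key hp hq hb)
  have h3 := abs_le.1 (key hq hp hc)
  have h4 := abs_le.1 (key hq hq hd)
  rw [abs_le]; constructor <;> nlinarith

lemma coord_le (z : E2) (i : Fin 2) : |z i| ≤ ‖z‖ := by
  simpa using PiLp.norm_apply_le z i

lemma taylor2 {V : E2 → ℝ} (hV : ContDiff ℝ 2 V) (y z : E2) {B : ℝ}
    (hB : ∀ x, ‖x - y‖ ≤ ‖z‖ → ∀ i j, |pd i (pd j V) x - pd i (pd j V) y| ≤ B) :
    |V (y + z) - T2 V y z| ≤ 4 * ‖z‖ ^ 2 * B := by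
  have dV := hV.differentiable (by norm_num)
  have dp := fun i => (pd_contDiff hV i).differentiable (by norm_num)
  set q : ℝ := z 0 * (z 0 * pd 0 (pd 0 V) y + z 1 * pd 1 (pd 0 V) y)
      + z 1 * (z 0 * pd 0 (pd 1 V) y + z 1 * pd 1 (pd 1 V) y) with hq
  set l : ℝ := z 0 * pd 0 V y + z 1 * pd 1 V y with hl
  have key := taylor1 (g := fun t => V (y + t • z) - (V y + t * l + t ^ 2 / 2 * q))
    (g' := fun t => (z 0 * pd 0 V (y + t • z) + z 1 * pd 1 V (y + t • z)) - (l + t * q))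
    (g'' := fun t => (z 0 * (z 0 * pd 0 (pd 0 V) (y + t • z) + z 1 * pd 1 (pd 0 V) (y + t • z))
      + z 1 * (z 0 * pd 0 (pd 1 V) (y + t • z) + z 1 * pd 1 (pd 1 V) (y + t • z))) - q)
    (B := 4 * ‖z‖ ^ 2 * B) ?_ ?_ ?_ ?_ ?_
  · have e : V (y + z) - T2 V y z = V (y + (1:ℝ) • z) - (V y + 1 * l + 1 ^ 2 / 2 * q) := by
      rw [one_smul]; unfold T2; rw [← hq, ← hl]; ring
    rw [e]; exact key
  · intro t
    have h1 := dir_deriv dV y z t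
    have h2 : HasDerivAt (fun t : ℝ => V y + t * l + t ^ 2 / 2 * q) (l + t * q) t := by
      have a := ((hasDerivAt_id t).mul_const l).const_add (V y)
      have b := (((hasDerivAt_id t).pow 2).div_const 2).mul_const q
      refine (a.add b).congr_deriv ?_
      simp
    exact h1.sub h2
  · intro t
    have h1 := ((dir_deriv (dp 0) y z t).const_mul (z 0)).add ((dir_deriv (dp 1) y z t).const_mul (z 1))
    have h2 : HasDerivAt (fun t : ℝ => l + t * q) q t := by
      simpa using ((hasDerivAt_id t).mul_const q).const_add l
    exact h1.sub h2
  · intro t ht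
    have hn : ‖y + t • z - y‖ ≤ ‖z‖ := by
      rw [add_sub_cancel_left, norm_smul, Real.norm_eq_abs, abs_of_nonneg ht.1]
      exact mul_le_of_le_one_left (norm_nonneg _) ht.2
    have b := hB _ hn
    have := quad_bd (coord_le z 0) (coord_le z 1) (b 0 0) (b 1 0) (b 0 1) (b 1 1)
    convert this using 2
    rw [hq]; ring
  · simp
  · simp [hl]

lemma dq_lim {f : E2 → ℝ} (hf : Differentiable ℝ f) (x : E2) (i : Fin 2) {c B : ℝ}
    {d : ℝ} (hd : 0 < d) {y : E2}
    (h : ∀ t, 0 < t → t ≤ d → |t⁻¹ * (f (x + t • EuclideanSpace.single i 1) - f x)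
      - c * (t⁻¹ * (f (y + t • EuclideanSpace.single i 1) - f y))| ≤ B) :
    |pd i f x - c * pd i f y| ≤ B := by
  have key : ∀ x : E2, Filter.Tendsto (fun t : ℝ => t⁻¹ * (f (x + t • EuclideanSpace.single i 1) - f x))
      (nhdsWithin 0 (Ioi 0)) (nhds (pd i f x)) := by
    intro x
    have := pd_line hf x i 0
    rw [zero_smul, add_zero, hasDerivAt_iff_tendsto_slope_zero] at this
    simp only [zero_add, zero_smul, add_zero, smul_eq_mul] at this
    exact this.mono_left (nhdsWithin_mono _ (by intro t ht; exact ne_of_gt ht))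
  have := ((key x).sub ((key y).const_mul c)).abs
  refine le_of_tendsto this ?_
  filter_upwards [Ioc_mem_nhdsGT hd] with t ht
  exact h t ht.1 ht.2

lemma hess_est {lam Lam : ℝ} (hlam : 0 < lam) (hLam : lam ≤ Lam) {F : Mat2 → ℝ}
    (hF : UniformlyElliptic lam Lam F) (hF0 : F 0 = 0) {V : E2 → ℝ} (hV : ContDiff ℝ 2 V)
    {x₀ : E2} {r S K C1 C2 : ℝ} (hr : 0 < r) (hK : K = 2 * Lam / lam) (hC1 : C1 = 200000 * K ^ 2)
    (hC2 : C2 = 160000 * K ^ 2 * C1)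
    (hS : ∀ x, ‖x - x₀‖ < 3 * r / 4 → |V x| ≤ S)
    (hs : ∀ x, ‖x - x₀‖ < 3 * r / 4 → F (hess V x) = 0) :
    (∀ i y, ‖y - x₀‖ ≤ r / 2 → |pd i V y| ≤ C1 * S / r) ∧
    (∀ i j, |pd i (pd j V) x₀| ≤ C2 * S / r ^ 2) ∧
    (∀ i j x, ‖x - x₀‖ ≤ r / 16 →
      |pd i (pd j V) x - pd i (pd j V) x₀| ≤ C2 * S / r ^ 2 * (4 * (‖x - x₀‖ / r)) ^ aK K) := by
  have hK1 : 1 ≤ K := by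
    rw [hK, le_div_iff₀ hlam]; linarith
  have dV := hV.differentiable (by norm_num)
  have dp := fun i => (pd_contDiff hV i).differentiable (by norm_num)
  have s1 : ∀ i y, ‖y - x₀‖ ≤ r / 2 → |pd i V y| ≤ C1 * S / r := by
    intro i y hy
    have tri : ∀ x, ‖x - y‖ ≤ r / 5 → ‖x - x₀‖ < 3 * r / 4 := by
      intro x hx
      have := norm_sub_le_norm_sub_add_norm_sub x y x₀
      linarith
    have := (scaled_est hV (K := K) (S := S) (R := r / 5) (y := y) hK1 (by positivity) ?_
      (fun x hx => hS x (tri x hx)) i).1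
    · refine this.trans (le_of_eq ?_)
      rw [hC1]; field_simp; ring
    · intro x hx
      have := ell_alg hlam hF (hess_herm hV x) (Matrix.isHermitian_zero) ((hs x (tri x hx)).trans hF0.symm)
      rw [← hK, sub_zero] at this
      exact EL_of_alg (c := 1) this (fun i j => (one_mul _).symm)
  have s2 : ∀ i j t, 0 < t → t ≤ r / 8 →
      |t⁻¹ * (pd j V (x₀ + t • EuclideanSpace.single i 1) - pd j V x₀)| ≤ C2 * S / r ^ 2 ∧
      ∀ x, ‖x - x₀‖ ≤ r / 16 → |t⁻¹ * (pd j V (x + t • EuclideanSpace.single i 1) - pd j V x)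
        - t⁻¹ * (pd j V (x₀ + t • EuclideanSpace.single i 1) - pd j V x₀)|
        ≤ C2 * S / r ^ 2 * (4 * (‖x - x₀‖ / r)) ^ aK K := by
    intro i j t ht htr
    set h : E2 := t • EuclideanSpace.single i 1 with hh
    have nh : ∀ s : ℝ, 0 ≤ s → s ≤ t → ‖s • (EuclideanSpace.single i 1 : E2)‖ ≤ r / 8 := by
      intro s h0 h1
      rw [norm_smul, single_norm, Real.norm_eq_abs, abs_of_nonneg h0]; linarith
    have cW : ContDiff ℝ 2 (fun x => t⁻¹ * (V (x + h) - V x)) :=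
      contDiff_const.mul ((hV.comp (contDiff_id.add contDiff_const)).sub hV)
    have trs : ∀ x, ‖x - x₀‖ ≤ r / 4 → ∀ s : ℝ, 0 ≤ s → s ≤ t →
        ‖x + s • (EuclideanSpace.single i 1 : E2) - x₀‖ ≤ r / 2 := by
      intro x hx s h0 h1
      rw [add_sub_right_comm]
      have := norm_add_le (x - x₀) (s • (EuclideanSpace.single i 1 : E2))
      have := nh s h0 h1
      linarith
    have eW : ∀ i, pd i (fun x => t⁻¹ * (V (x + h) - V x)) = fun x => t⁻¹ * (pd i V (x + h) - pd i V x) :=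
      fun i => pd_dq dV _ _ i
    have ab := scaled_est cW (K := K) (S := C1 * S / r) (R := r / 4) (y := x₀) hK1 (by positivity) ?_ ?_ j
    · obtain ⟨a, b⟩ := ab
      have e : 40000 * K ^ 2 * (C1 * S / r) / (r / 4) = C2 * S / r ^ 2 := by
        rw [hC2]; field_simp; ring
      rw [eW, e] at a
      rw [eW, e] at b
      refine ⟨a, fun x hx => ?_⟩
      have := b x (by linarith)
      have e2 : 4 * (‖x - x₀‖ / r) = ‖x - x₀‖ / (r / 4) := by field_simp
      rw [e2]; exact this
    · intro x hx
      have hx1 : ‖x - x₀‖ < 3 * r / 4 := by linarith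
      have hx2 : ‖x + h - x₀‖ < 3 * r / 4 := by
        have := trs x hx t ht.le le_rfl
        rw [← hh] at this; linarith
      have := ell_alg hlam hF (hess_herm hV (x + h)) (hess_herm hV x) ((hs _ hx2).trans (hs _ hx1).symm)
      rw [← hK] at this
      refine EL_of_alg (c := t⁻¹) this (fun i j => ?_)
      rw [eW, pd_dq (dp j)]; rfl
    · intro x hx
      have := (convex_Icc (0:ℝ) t).norm_image_sub_le_of_norm_hasDerivWithin_le
        (fun s _ => (pd_line dV x i s).hasDerivWithinAt)
        (fun s hs => s1 i _ (trs x hx s hs.1 hs.2)) (left_mem_Icc.2 ht.le) (right_mem_Icc.2 ht.le)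
      rw [zero_smul, add_zero, sub_zero, Real.norm_eq_abs, Real.norm_eq_abs, abs_of_pos ht] at this
      rw [abs_mul, abs_of_pos (inv_pos.2 ht), inv_mul_le_iff₀ ht]
      linarith
  refine ⟨s1, ?_, ?_⟩
  · intro i j
    have := dq_lim (dp j) x₀ i (c := 0) (B := C2 * S / r ^ 2) (d := r / 8) (y := x₀) (by positivity) ?_
    · simpa using this
    · intro t h0 h1
      simpa using (s2 i j t h0 h1).1
  · intro i j x hx
    have := dq_lim (dp j) x i (c := 1) (B := C2 * S / r ^ 2 * (4 * (‖x - x₀‖ / r)) ^ aK K)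
      (d := r / 8) (y := x₀) (by positivity) ?_
    · simpa using this
    · intro t h0 h1
      simpa using (s2 i j t h0 h1).2 x hx


lemma le_supAbs {v : E2 → ℝ} {x₀ : E2} {r : ℝ} (hv : ContinuousOn v (closedBall x₀ r)) {x : E2}
    (hx : x ∈ ball x₀ r) : |v x| ≤ supAbs v (ball x₀ r) := by
  obtain ⟨B, hB⟩ := (isCompact_closedBall x₀ r).exists_bound_of_continuousOn hv
  have hB0 : 0 ≤ B := (norm_nonneg _).trans (hB x (ball_subset_closedBall hx))
  have e : ∀ y, (⨆ _ : y ∈ ball x₀ r, |v y|) ≤ B := by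
    intro y
    by_cases hy : y ∈ ball x₀ r
    · rw [ciSup_pos hy]; exact hB y (ball_subset_closedBall hy)
    · have : IsEmpty (y ∈ ball x₀ r) := ⟨hy⟩
      rw [Real.iSup_of_isEmpty]; exact hB0
  have := le_ciSup (f := fun y => ⨆ _ : y ∈ ball x₀ r, |v y|) ⟨B, by rintro _ ⟨y, rfl⟩; exact e y⟩ x
  simp only [ciSup_pos hx] at this
  exact this

lemma cutoff {v : E2 → ℝ} {x₀ : E2} {r : ℝ} (hr : 0 < r) (hv : ContDiffOn ℝ 2 v (closedBall x₀ r)) :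
    ∃ V : E2 → ℝ, ContDiff ℝ 2 V ∧ ∀ x, ‖x - x₀‖ < 3 * r / 4 → V x = v x ∧ hess V x = hess v x := by
  let f : ContDiffBump x₀ := ⟨3 * r / 4, 7 * r / 8, by positivity, by linarith⟩
  refine ⟨fun x => f x * v x, ?_, ?_⟩
  · rw [contDiff_iff_contDiffAt]
    intro x
    by_cases hx : x ∈ ball x₀ r
    · have : ContDiffAt ℝ 2 v x := hv.contDiffAt
        (Filter.mem_of_superset (isOpen_ball.mem_nhds hx) ball_subset_closedBall)
      exact f.contDiffAt.mul this
    · have hx' : x ∈ (closedBall x₀ (7 * r / 8))ᶜ := by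
        simp only [mem_ball, mem_compl_iff, mem_closedBall, not_lt, not_le] at hx ⊢
        linarith
      have : (fun x => f x * v x) =ᶠ[nhds x] fun _ => (0:ℝ) := by
        filter_upwards [isClosed_closedBall.isOpen_compl.mem_nhds hx'] with y hy
        have hy2 : f.rOut ≤ dist y x₀ := by
          simp only [mem_compl_iff, mem_closedBall, not_le] at hy
          exact hy.le
        rw [f.zero_of_le_dist hy2, zero_mul]
      exact contDiffAt_const.congr_of_eventuallyEq this
  · intro x hx
    have hxb : x ∈ ball x₀ (3 * r / 4) := by rwa [mem_ball, dist_eq_norm]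
    have ev : ∀ y ∈ ball x₀ (3 * r / 4), (fun x => f x * v x) =ᶠ[nhds y] v := by
      intro y hy
      filter_upwards [f.eventuallyEq_one_of_mem_ball hy] with z hz
      simp [hz]
    refine ⟨(ev x hxb).eq_of_nhds, ?_⟩
    unfold hess
    ext i j
    simp only [Matrix.of_apply]
    have : (fun y => fderiv ℝ (fun x => f x * v x) y (EuclideanSpace.single j 1)) =ᶠ[nhds x]
        fun y => fderiv ℝ v y (EuclideanSpace.single j 1) := by
      filter_upwards [isOpen_ball.mem_nhds hxb] with y hy
      rw [(ev y hy).fderiv_eq]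
    rw [this.fderiv_eq]

lemma quad_est {lam Lam : ℝ} (hlam : 0 < lam) (hLam : lam ≤ Lam) {F : Mat2 → ℝ}
    (hF : UniformlyElliptic lam Lam F) (hF0 : F 0 = 0) {V : E2 → ℝ} (hV : ContDiff ℝ 2 V)
    {x₀ : E2} {r S K C1 C2 : ℝ} (hr : 0 < r) (hK : K = 2 * Lam / lam) (hC1 : C1 = 200000 * K ^ 2)
    (hC2 : C2 = 160000 * K ^ 2 * C1) (hα : 0 < aK K) (hα1 : aK K < 1)
    (hS : ∀ x, ‖x - x₀‖ < 3 * r / 4 → |V x| ≤ S)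
    (hs : ∀ x, ‖x - x₀‖ < 3 * r / 4 → F (hess V x) = 0) (z : E2) (hz : ‖z‖ < r / 2) :
    |V (x₀ + z) - T2 V x₀ z| ≤ 4096 * (2 + C1 + C2) * S * (‖z‖ / r) ^ (2 + aK K) := by
  obtain ⟨g1, g2, g3⟩ := hess_est hlam hLam hF hF0 hV hr hK hC1 hC2 hS hs
  have hC10 : 0 ≤ C1 := by rw [hC1]; positivity
  have hC20 : 0 ≤ C2 := by rw [hC2]; positivity
  have hS0 : 0 ≤ S := (abs_nonneg _).trans (hS x₀ (by simpa using hr))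
  set α := aK K
  set ρ := ‖z‖ / r with hρ
  have hρ0 : 0 ≤ ρ := by positivity
  have hzρ : ‖z‖ = ρ * r := by rw [hρ]; field_simp
  by_cases hsm : ‖z‖ ≤ r / 16
  · have := taylor2 hV x₀ z (B := C2 * S / r ^ 2 * (4 * ρ) ^ α) ?_
    · refine this.trans ?_
      have e1 : 4 * ‖z‖ ^ 2 * (C2 * S / r ^ 2 * (4 * ρ) ^ α) = 4 * (4:ℝ) ^ α * C2 * S * (ρ ^ 2 * ρ ^ α) := by
        rw [Real.mul_rpow (by norm_num) hρ0, hzρ]; field_simp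
      have e2 : ρ ^ 2 * ρ ^ α = ρ ^ (2 + α) := by
        rw [Real.rpow_add_of_nonneg hρ0 (by norm_num) hα.le, Real.rpow_two]
      have e3 : (4:ℝ) ^ α ≤ 4 := by
        have := Real.rpow_le_rpow_of_exponent_le (by norm_num : (1:ℝ) ≤ 4) hα1.le
        simpa using this
      rw [e1, e2]
      have : 0 ≤ ρ ^ (2 + α) := by positivity
      apply mul_le_mul_of_nonneg_right _ this
      apply mul_le_mul_of_nonneg_right _ hS0
      nlinarith
    · intro x hx i j
      refine (g3 i j x (hx.trans hsm)).trans ?_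
      rw [hρ]
      gcongr
  · have hl : |z 0 * pd 0 V x₀ + z 1 * pd 1 V x₀| ≤ C1 * S := by
      have k : ∀ i, |z i * pd i V x₀| ≤ C1 * S / 2 := by
        intro i
        rw [abs_mul]
        calc |z i| * |pd i V x₀| ≤ (r / 2) * (C1 * S / r) :=
              mul_le_mul ((coord_le z i).trans hz.le) (g1 i x₀ (by simp; positivity)) (abs_nonneg _) (by positivity)
          _ = _ := by field_simp
      have := abs_add_le (z 0 * pd 0 V x₀) (z 1 * pd 1 V x₀)
      linarith [k 0, k 1]
    have hq := quad_bd (n := r / 2) ((coord_le z 0).trans hz.le) ((coord_le z 1).trans hz.le) (g2 0 0) (g2 1 0) (g2 0 1) (g2 1 1)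
    have e : 4 * (r / 2) ^ 2 * (C2 * S / r ^ 2) = C2 * S := by field_simp; ring
    rw [e] at hq
    have hv1 := hS (x₀ + z) (by rw [add_sub_cancel_left]; linarith)
    have hv0 := hS x₀ (by simpa using hr)
    have tot : |V (x₀ + z) - T2 V x₀ z| ≤ (2 + C1 + C2) * S := by
      have hc : 0 ≤ C2 * S := by positivity
      unfold T2
      rw [abs_le] at *
      constructor <;> linarith [hq.1, hq.2, hl.1, hl.2, hv0.1, hv0.2, hv1.1, hv1.2]
    refine tot.trans ?_
    have h1 : 1 ≤ (16 * ρ) ^ (2 + α) := by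
      apply Real.one_le_rpow _ (by linarith)
      rw [hρ, mul_div_assoc', le_div_iff₀ hr]; linarith
    rw [Real.mul_rpow (by norm_num) hρ0] at h1
    have h2 : (16:ℝ) ^ (2 + α) ≤ 4096 := by
      have := Real.rpow_le_rpow_of_exponent_le (by norm_num : (1:ℝ) ≤ 16) (by push_cast; linarith : 2 + α ≤ ((3:ℕ):ℝ))
      rw [Real.rpow_natCast] at this
      norm_num at this ⊢; exact this
    have h3 : 1 ≤ 4096 * ρ ^ (2 + α) := h1.trans (by gcongr)
    have h4 : 0 ≤ (2 + C1 + C2) * S := by positivity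
    nlinarith

theorem main_aux (lam Lam : ℝ) (hlam : 0 < lam) (hLam : lam ≤ Lam) :
    ∃ α C : ℝ, α ∈ Set.Ioo (0 : ℝ) 1 ∧ 0 < C ∧
      ∀ (r : ℝ) (x₀ : E2) (F : Mat2 → ℝ) (v : E2 → ℝ),
        0 < r →
        UniformlyElliptic lam Lam F → F 0 = 0 →
        ContDiffOn ℝ 2 v (closedBall x₀ r) →
        (∀ x ∈ ball x₀ r, F (hess v x) = 0) →
        ∃ P : QuadPoly,
          (∀ x ∈ ball x₀ (r / 2),
            |v x - P.eval x| ≤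
              C * supAbs v (ball x₀ r) * r ^ (-(2 + α) : ℝ) * ‖x - x₀‖ ^ (2 + α)) ∧
          |P.eval x₀| ≤ C * supAbs v (ball x₀ r) ∧
          vecNorm (P.grad x₀) ≤ C * r⁻¹ * supAbs v (ball x₀ r) ∧
          matNorm P.Q ≤ C * r⁻¹ ^ 2 * supAbs v (ball x₀ r) := by
  obtain ⟨K, hK⟩ : ∃ K, K = 2 * Lam / lam := ⟨_, rfl⟩
  obtain ⟨C1, hC1⟩ : ∃ C1, C1 = 200000 * K ^ 2 := ⟨_, rfl⟩
  obtain ⟨C2, hC2⟩ : ∃ C2, C2 = 160000 * K ^ 2 * C1 := ⟨_, rfl⟩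
  have hK1 : 1 ≤ K := by rw [hK, le_div_iff₀ hlam]; linarith
  have hα : 0 < aK K := by unfold aK; positivity
  have hα1 : aK K < 1 := by
    unfold aK
    rw [div_lt_one (by positivity)]
    nlinarith [Real.pi_gt_three]
  have hC10 : 0 ≤ C1 := by rw [hC1]; positivity
  have hC20 : 0 ≤ C2 := by rw [hC2]; positivity
  refine ⟨aK K, 4096 * (2 + C1 + C2), ⟨hα, hα1⟩, by positivity, ?_⟩
  intro r x₀ F v hr hF hF0 hv hs
  obtain ⟨V, hV, hVv⟩ := cutoff hr hv
  set S := supAbs v (ball x₀ r) with hSdef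
  have inb : ∀ x, ‖x - x₀‖ < 3 * r / 4 → x ∈ ball x₀ r := by
    intro x hx; rw [mem_ball, dist_eq_norm]; linarith
  have hS : ∀ x, ‖x - x₀‖ < 3 * r / 4 → |V x| ≤ S := by
    intro x hx; rw [(hVv x hx).1]; exact le_supAbs hv.continuousOn (inb x hx)
  have hsV : ∀ x, ‖x - x₀‖ < 3 * r / 4 → F (hess V x) = 0 := by
    intro x hx; rw [(hVv x hx).2]; exact hs x (inb x hx)
  obtain ⟨g1, g2, -⟩ := hess_est hlam hLam hF hF0 hV hr hK hC1 hC2 hS hsV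
  have q := quad_est hlam hLam hF hF0 hV hr hK hC1 hC2 hα hα1 hS hsV
  have hS0 : 0 ≤ S := (abs_nonneg _).trans (hS x₀ (by simpa using hr))
  let P : QuadPoly :=
    { a := V x₀ - (x₀ 0 * pd 0 V x₀ + x₀ 1 * pd 1 V x₀)
        + 1 / 2 * (x₀ 0 * (x₀ 0 * pd 0 (pd 0 V) x₀ + x₀ 1 * pd 1 (pd 0 V) x₀)
          + x₀ 1 * (x₀ 0 * pd 0 (pd 1 V) x₀ + x₀ 1 * pd 1 (pd 1 V) x₀))
      b := fun i => pd i V x₀ - (pd i (pd 0 V) x₀ * x₀ 0 + pd i (pd 1 V) x₀ * x₀ 1)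
      Q := hess V x₀
      symm := hess_herm hV x₀ }
  have hQ : ∀ i j, P.Q i j = pd i (pd j V) x₀ := fun i j => rfl
  have sy := pd_symm hV x₀
  have ev : ∀ z, P.eval (x₀ + z) = T2 V x₀ z := by
    intro z
    unfold QuadPoly.eval T2
    simp only [Fin.sum_univ_two, hQ, PiLp.add_apply]
    simp only [P]
    rw [sy]; ring
  have gr : P.grad x₀ = fun i => pd i V x₀ := by
    funext i
    unfold QuadPoly.grad
    simp only [Fin.sum_univ_two, hQ]
    simp only [P]; ring
  refine ⟨P, ?_, ?_, ?_, ?_⟩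
  · intro x hx
    rw [mem_ball, dist_eq_norm] at hx
    have := q (x - x₀) hx
    rw [← ev, add_sub_cancel, (hVv x (by linarith)).1, Real.div_rpow (norm_nonneg _) hr.le] at this
    rw [Real.rpow_neg hr.le]
    refine this.trans (le_of_eq ?_)
    rw [div_eq_mul_inv]; ring
  · have := ev 0
    rw [add_zero] at this
    rw [this]
    have e : T2 V x₀ 0 = V x₀ := by simp [T2]
    rw [e]
    refine (hS x₀ (by simpa using hr)).trans ?_
    nlinarith [mul_nonneg hC10 hS0, mul_nonneg hC20 hS0]
  · rw [gr]
    have k := fun i => g1 i x₀ (by simp; positivity)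
    have hb : 0 ≤ C1 * S / r := by positivity
    have : vecNorm (fun i => pd i V x₀) ≤ 2 * (C1 * S / r) := by
      unfold vecNorm
      rw [Real.sqrt_le_left (by positivity), Fin.sum_univ_two]
      have k0 := sq_le_sq' (abs_le.1 (k 0)).1 (abs_le.1 (k 0)).2
      have k1 := sq_le_sq' (abs_le.1 (k 1)).1 (abs_le.1 (k 1)).2
      nlinarith
    refine this.trans ?_
    have e : 2 * (C1 * S / r) = 2 * C1 * r⁻¹ * S := by ring
    rw [e]
    gcongr
    · norm_num
    · linarith
  · unfold matNorm
    simp only [Fin.sum_univ_two, hQ]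
    have e : 4 * (C2 * S / r ^ 2) = 4 * C2 * r⁻¹ ^ 2 * S := by field_simp
    have : 4 * C2 * r⁻¹ ^ 2 * S ≤ 4096 * (2 + C1 + C2) * r⁻¹ ^ 2 * S := by
      gcongr
      · norm_num
      · linarith
    linarith [g2 0 0, g2 0 1, g2 1 0, g2 1 1]

/-- Scaled interior pointwise `C^{2,ᾱ}` estimate: there are universal constants `ᾱ ∈ (0,1)`
and `C > 0` depending only on `lam, Lam` such that for any `0 < r ≤ 1`, any `x₀ ∈ ℝ²`, any
`C¹` uniformly elliptic `F` with `F(0) = 0`, and any classical solution `v ∈ C²(B̄_r(x₀))`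
of `F(D²v) = 0` in `B_r(x₀)`, there is a quadratic polynomial `P` with
`|v(x) − P(x)| ≤ C‖v‖_∞ r^{−(2+ᾱ)}|x−x₀|^{2+ᾱ}` on `B_{r/2}(x₀)`,
`|P(x₀)| ≤ C‖v‖_∞`, `|DP(x₀)| ≤ C r⁻¹‖v‖_∞` and `|D²P| ≤ C r⁻²‖v‖_∞`, where
`‖v‖_∞ = ‖v‖_{L^∞(B_r(x₀))}`. -/
theorem scaled_interior_pointwise_estimate (lam Lam : ℝ) (hlam : 0 < lam) (hLam : lam ≤ Lam) :
    ∃ α C : ℝ, α ∈ Set.Ioo (0 : ℝ) 1 ∧ 0 < C ∧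
      ∀ (r : ℝ) (x₀ : E2) (F : Mat2 → ℝ) (v : E2 → ℝ),
        0 < r → r ≤ 1 →
        ContDiff ℝ 1 (fun A : Fin 2 → Fin 2 → ℝ => F (Matrix.of A)) →
        UniformlyElliptic lam Lam F → F 0 = 0 →
        ContDiffOn ℝ 2 v (closedBall x₀ r) →
        (∀ x ∈ ball x₀ r, F (hess v x) = 0) →
        ∃ P : QuadPoly,
          (∀ x ∈ ball x₀ (r / 2),
            |v x - P.eval x| ≤
              C * supAbs v (ball x₀ r) * r ^ (-(2 + α) : ℝ) * ‖x - x₀‖ ^ (2 + α)) ∧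
          |P.eval x₀| ≤ C * supAbs v (ball x₀ r) ∧
          vecNorm (P.grad x₀) ≤ C * r⁻¹ * supAbs v (ball x₀ r) ∧
          matNorm P.Q ≤ C * r⁻¹ ^ 2 * supAbs v (ball x₀ r) := by
  obtain ⟨α, C, hα, hC, h⟩ := main_aux lam Lam hlam hLam
  exact ⟨α, C, hα, hC, fun r x₀ F v hr _ _ hF hF0 hv hs => h r x₀ F v hr hF hF0 hv hs⟩
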